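/- arXiv:1101.0289 — 6 statements merged into one kernel-verified Lean document; each statement's English description precedes it below -/
import Mathlib

section
/- Let F_q be the finite field of q elements of characteristic p, let H be a multiplicative subgroup of F_q^* of index m (so |H| = (q-1)/m), let 1 ≤ k ≤ (q-1)/m, and let b ∈ F_q with b ≠ 0. Then |M_H(k,b) − (1/q)·C((q-1)/m, k)| ≤ (2/√q)·C(√q + k + q/(m·p), k), where C(t,k) = t(t−1)⋯(t−k+1)/k! denotes the generalized binomial coefficient for a real number t. -/
/-- `MH H k b` is the number of `k`-element subsets `S` of the multiplicative
subgroup `H ⊆ Fˣ` (viewed inside `F`) with `∑_{a ∈ S} a = b`. -/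
noncomputable def MH {F : Type*} [Field F] (H : Subgroup Fˣ) (k : ℕ) (b : F) : ℕ :=
  Nat.card {S : Finset F //
    S.card = k ∧ (∀ x ∈ S, ∃ u : Fˣ, u ∈ H ∧ (u : F) = x) ∧ ∑ x ∈ S, x = b}

/-- The generalized binomial coefficient `C(t, k) = t(t-1)⋯(t-k+1)/k!` for real `t`. -/
noncomputable def genChoose (t : ℝ) (k : ℕ) : ℝ :=
  (descPochhammer ℝ k).eval t / (Nat.factorial k)

section RisingBinomial

theorem genChoose_add_sub_one (c : ℝ) (k : ℕ) :
    genChoose (c - 1 + k) k = (ascPochhammer ℝ k).eval c / k.factorial := by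
  rw [genChoose, descPochhammer_eval_eq_ascPochhammer]
  congr 2
  ring

/-- The coefficient of `t ^ k` in `(1 - t) ^ (-c)`. -/
noncomputable def risingChoose (c : ℝ) (k : ℕ) : ℝ :=
  (ascPochhammer ℝ k).eval c / k.factorial

theorem risingChoose_zero (c : ℝ) : risingChoose c 0 = 1 := by
  simp [risingChoose]

theorem succ_mul_risingChoose_succ (c : ℝ) (k : ℕ) :
    (k + 1) * risingChoose c (k + 1) = (c + k) * risingChoose c k := by
  have : (k.factorial : ℝ) ≠ 0 := by positivity
  have : (k : ℝ) + 1 ≠ 0 := by positivity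
  simp only [risingChoose, ascPochhammer_succ_eval, Nat.factorial_succ]
  push_cast
  field_simp

theorem risingChoose_nonneg {c : ℝ} (hc : 1 ≤ c) (k : ℕ) : 0 ≤ risingChoose c k :=
  div_nonneg (ascPochhammer_pos k c (by linarith)).le (by positivity)

theorem risingChoose_monotone {c : ℝ} (hc : 1 ≤ c) : Monotone (risingChoose c) := by
  refine monotone_nat_of_le_succ fun k => ?_
  have h := succ_mul_risingChoose_succ c k
  have h0 := risingChoose_nonneg hc k
  have hk : (0 : ℝ) < k + 1 := by positivity
  refine le_of_mul_le_mul_left ?_ hk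
  rw [h]
  exact mul_le_mul_of_nonneg_right (by linarith) h0

theorem mul_sum_risingChoose (c : ℝ) (k : ℕ) :
    c * ∑ i ∈ Finset.range k, risingChoose c i = k * risingChoose c k := by
  induction k with
  | zero => simp
  | succ k ih =>
    rw [Finset.sum_range_succ, mul_add, ih]
    push_cast
    rw [succ_mul_risingChoose_succ]
    ring

theorem mul_sum_ite_dvd_le_sum {T : ℕ → ℝ} (hT : Monotone T) (h0 : ∀ i, 0 ≤ T i) {p : ℕ}
    (hp : 0 < p) (k : ℕ) :
    p * ∑ i ∈ Finset.range k, (if p ∣ k - i then T i else 0) ≤ ∑ i ∈ Finset.range k, T i := by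
  induction k using Nat.strong_induction_on with
  | _ k ih =>
    rcases lt_or_ge k p with hk | hk
    · rw [Finset.sum_eq_zero, mul_zero]
      · exact Finset.sum_nonneg fun i _ => h0 i
      · intro i hi
        rw [Finset.mem_range] at hi
        refine if_neg fun h => ?_
        have := Nat.le_of_dvd (by omega) h
        omega
    · obtain ⟨l, rfl⟩ := Nat.exists_eq_add_of_le' hk
      rw [Finset.sum_range_add, Finset.sum_range_add, mul_add]
      refine add_le_add ?_ ?_
      · refine le_trans (le_of_eq ?_) (ih l (by omega))
        congr 1
        refine Finset.sum_congr rfl fun i hi => ?_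
        rw [Finset.mem_range] at hi
        have : l + p - i = (l - i) + p := by omega
        simp only [this, Nat.dvd_add_self_right]
      · have h1 : ∑ r ∈ Finset.range p, (if p ∣ l + p - (l + r) then T (l + r) else 0) = T l := by
          rw [Finset.sum_eq_single_of_mem 0 (Finset.mem_range.2 hp)]
          · simp
          · intro r hr hr0
            rw [Finset.mem_range] at hr
            refine if_neg fun h => ?_
            have := Nat.le_of_dvd (by omega) h
            omega
        rw [h1]
        calc p * T l = ∑ _r ∈ Finset.range p, T l := by simp
          _ ≤ _ := Finset.sum_le_sum fun r _ => hT (Nat.le_add_right l r)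

theorem sum_weight_mul_risingChoose_le {r n s : ℝ} {p : ℕ} (hp : 0 < p) (hr : 0 ≤ r)
    (hs : 0 ≤ s) (hn : n ≤ p * s) (k : ℕ) :
    ∑ i ∈ Finset.range k, risingChoose (r + s + 1) i * (if p ∣ k - i then n else r)
      ≤ k * risingChoose (r + s + 1) k := by
  have hr1 : 1 ≤ r + s + 1 := by linarith
  have h0 := risingChoose_nonneg hr1
  have hblock := mul_sum_ite_dvd_le_sum (risingChoose_monotone hr1) h0 hp k
  have hD : 0 ≤ ∑ i ∈ Finset.range k,
      (if p ∣ k - i then risingChoose (r + s + 1) i else 0) :=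
    Finset.sum_nonneg fun i _ => by split_ifs <;> simp [h0]
  have hS : 0 ≤ ∑ i ∈ Finset.range k, risingChoose (r + s + 1) i :=
    Finset.sum_nonneg fun i _ => h0 i
  rw [← mul_sum_risingChoose]
  set T := risingChoose (r + s + 1)
  have hle : ∑ i ∈ Finset.range k, T i * (if p ∣ k - i then n else r) ≤
      r * ∑ i ∈ Finset.range k, T i +
        n * ∑ i ∈ Finset.range k, (if p ∣ k - i then T i else 0) := by
    rw [Finset.mul_sum, Finset.mul_sum, ← Finset.sum_add_distrib]
    refine Finset.sum_le_sum fun i _ => ?_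
    have := mul_nonneg hr (h0 i)
    split_ifs <;> linarith
  have hD' : n * ∑ i ∈ Finset.range k, (if p ∣ k - i then T i else 0) ≤
      s * ∑ i ∈ Finset.range k, T i := by
    refine (mul_le_mul_of_nonneg_right hn hD).trans ?_
    rw [mul_comm (p : ℝ) s, mul_assoc]
    exact mul_le_mul_of_nonneg_left hblock hs
  linarith

end RisingBinomial

section CharCombination

variable {F : Type*} [Field F]

/-- `CharCombination f B` says that `f` is a linear combination of multiplicative characters whose
coefficients have absolute values summing to at most `B`. -/
inductive CharCombination : (Fˣ → ℂ) → ℝ → Prop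
  | smul_apply (c : ℂ) (χ : MulChar F ℂ) : CharCombination (fun a => c * χ a) ‖c‖
  | zero : CharCombination 0 0
  | add {f g : Fˣ → ℂ} {A B : ℝ} :
      CharCombination f A → CharCombination g B → CharCombination (f + g) (A + B)
  | mono {f : Fˣ → ℂ} {A B : ℝ} : CharCombination f A → A ≤ B → CharCombination f B

namespace CharCombination

variable {f g : Fˣ → ℂ} {A B : ℝ}

theorem bound_nonneg (h : CharCombination f A) : 0 ≤ A := by
  induction h with
  | smul_apply c χ => exact norm_nonneg c
  | zero => exact le_rfl
  | add _ _ h₁ h₂ => exact add_nonneg h₁ h₂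
  | mono _ h₁ h₂ => exact h₂.trans h₁

theorem char_mul (h : CharCombination f A) (c : ℂ) (χ : MulChar F ℂ) :
    CharCombination (fun a => c * χ a * f a) (‖c‖ * A) := by
  induction h with
  | smul_apply d θ =>
    have := smul_apply (c * d) (χ * θ)
    rw [norm_mul] at this
    convert this using 2 with a
    rw [MulChar.mul_apply]
    ring
  | zero => simpa using! zero (F := F)
  | add _ _ h₁ h₂ =>
    rw [mul_add]
    convert h₁.add h₂ using 2 with a
    simp [mul_add]
  | mono _ h₁ h₂ => exact h₂.mono (mul_le_mul_of_nonneg_left h₁ (norm_nonneg c))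

theorem mul (hf : CharCombination f A) (hg : CharCombination g B) :
    CharCombination (f * g) (A * B) := by
  induction hf with
  | smul_apply c χ => exact hg.char_mul c χ
  | zero => simpa using zero (F := F)
  | add _ _ h₁ h₂ => rw [add_mul, add_mul]; exact h₁.add h₂
  | mono _ h₁ h₂ => exact h₂.mono (mul_le_mul_of_nonneg_right h₁ hg.bound_nonneg)

theorem const (c : ℂ) : CharCombination (F := F) (fun _ => c) ‖c‖ := by
  simpa using smul_apply (F := F) c 1

theorem const_mul (hf : CharCombination f A) (c : ℂ) :
    CharCombination (fun a => c * f a) (‖c‖ * A) :=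
  (const c).mul hf

theorem sum {ι : Type*} (s : Finset ι) {f : ι → Fˣ → ℂ} {A : ι → ℝ}
    (h : ∀ i ∈ s, CharCombination (f i) (A i)) :
    CharCombination (∑ i ∈ s, f i) (∑ i ∈ s, A i) := by
  classical
  induction s using Finset.induction_on with
  | empty => simpa using zero (F := F)
  | insert i s hi ih =>
    rw [Finset.sum_insert hi, Finset.sum_insert hi]
    exact (h i (Finset.mem_insert_self i s)).add
      (ih fun j hj => h j (Finset.mem_insert_of_mem hj))

theorem comp_mul_left (h : CharCombination f A) (u : Fˣ) (hA : ∀ χ : MulChar F ℂ, ‖χ u‖ = 1) :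
    CharCombination (fun a => f (u * a)) A := by
  induction h with
  | smul_apply c χ =>
    have := smul_apply (c * χ u) χ
    rw [norm_mul, hA, mul_one] at this
    convert this using 2 with a
    simp [mul_assoc]
  | zero => exact zero
  | add _ _ h₁ h₂ => exact h₁.add h₂
  | mono _ h₁ h₂ => exact h₂.mono h₁

end CharCombination

end CharCombination

section FiniteField

variable {F : Type*} [Field F] [Fintype F]

theorem norm_mulChar_unit (χ : MulChar F ℂ) (u : Fˣ) : ‖χ u‖ = 1 := by
  have h : (χ u) ^ Nat.card Fˣ = 1 := by
    rw [← map_pow, ← Units.val_pow_eq_pow_val, pow_card_eq_one']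
    simp
  exact Complex.norm_eq_one_of_pow_eq_one h Nat.card_pos.ne'

theorem norm_gaussSum_le (χ : MulChar F ℂ) {ψ : AddChar F ℂ} (hψ : ψ.IsPrimitive) :
    ‖gaussSum χ ψ‖ ≤ √(Fintype.card F) := by
  by_cases hχ : χ = 1
  · have hψ1 : ψ ≠ 1 := by simpa using hψ one_ne_zero
    rw [hχ, gaussSum_one_left hψ1, norm_neg, norm_one, Real.one_le_sqrt]
    exact_mod_cast Fintype.card_pos
  · have h := gaussSum_mul_gaussSum_eq_card hχ hψ
    rw [← star_gaussSum_eq, ← starRingEnd_apply, Complex.mul_conj'] at h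
    have h' : ‖gaussSum χ ψ‖ ^ 2 = Fintype.card F := by exact_mod_cast h
    rw [← h', Real.sqrt_sq (norm_nonneg _)]

theorem sum_eq_zero_add_sum_units [Fintype Fˣ] (f : F → ℂ) :
    ∑ x : F, f x = f 0 + ∑ x : Fˣ, f x := by
  classical
  rw [← Finset.add_sum_erase Finset.univ f (Finset.mem_univ 0)]
  congr 1
  rw [Finset.sum_subtype (p := fun x : F => x ≠ 0) _ (by simp)]
  exact (Fintype.sum_equiv unitsEquivNeZero _ _ fun x => rfl).symm

theorem sum_units_mulChar_mul [Fintype Fˣ] (χ : MulChar F ℂ) (f : F → ℂ) :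
    ∑ x : Fˣ, χ x * f x = ∑ x : F, χ x * f x := by
  simp [sum_eq_zero_add_sum_units fun x => χ x * f x, MulChar.map_zero]

theorem exists_mulChar_sum_eq_card_or_zero (H : Subgroup Fˣ) :
    ∃ X : Finset (MulChar F ℂ), X.Nonempty ∧ (∀ x ∈ H, ∑ χ ∈ X, χ x = X.card) ∧
      ∀ x : Fˣ, x ∉ H → ∑ χ ∈ X, χ x = 0 := by
  classical
  let X : Subgroup (MulChar F ℂ) := (MulChar.subgroupOrderIsoSubgroupMulChar F ℂ H).ofDual
  have hX : ∀ χ : MulChar F ℂ, χ ∈ X ↔ ∀ x ∈ H, χ x = 1 := fun χ =>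
    MulChar.mem_subgroupOrderIsoSubgroupMulChar_iff
  have hH : ∀ x : Fˣ, x ∈ H ↔ ∀ χ ∈ X, χ x = 1 := fun x => by
    rw [← MulChar.mem_subgroupOrderIsoSubgroupMulChar_symm_iff (R := ℂ)]
    simp only [X, OrderDual.toDual_ofDual, OrderIso.symm_apply_apply]
  have := Fintype.ofFinite (MulChar F ℂ)
  refine ⟨Finset.univ.filter (· ∈ X), ⟨1, by simp [X.one_mem]⟩, fun x hx => ?_, fun x hx => ?_⟩
  · rw [Finset.sum_congr rfl fun χ hχ => (hX χ).1 (Finset.mem_filter.1 hχ).2 x hx]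
    simp
  · let ev : X →* ℂ :=
      { toFun := fun χ => χ.1 x
        map_one' := by simp
        map_mul' := fun χ θ => by simp [MulChar.mul_apply] }
    have hev : ev ≠ 1 := fun h => hx ((hH x).2 fun χ hχ => DFunLike.congr_fun h ⟨χ, hχ⟩)
    rw [Finset.sum_subtype (p := (· ∈ X)) _ (by simp)]
    exact sum_hom_units_eq_zero ev hev

theorem charCombination_sum_subgroup {ψ : AddChar F ℂ} (hψ : ψ.IsPrimitive) (H : Subgroup Fˣ)
    [Fintype H] :
    CharCombination (fun a : Fˣ => ∑ x : H, ψ (a * (x : Fˣ))) √(Fintype.card F) := by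
  classical
  obtain ⟨X, hX, hmem, hnot⟩ := exists_mulChar_sum_eq_card_or_zero H
  have hX0 : (X.card : ℂ) ≠ 0 := by exact_mod_cast hX.card_ne_zero
  have key : (fun a : Fˣ => ∑ x : H, ψ (a * (x : Fˣ))) =
      ∑ χ ∈ X, fun a : Fˣ => ((X.card : ℂ)⁻¹ * gaussSum χ ψ) * χ⁻¹ a := by
    funext a
    have h1 : ∀ χ : MulChar F ℂ, gaussSum χ ψ * χ⁻¹ a = ∑ x : Fˣ, χ x * ψ (a * x) := by
      intro χ
      rw [← gaussSum_mulShift χ ψ a, mul_right_comm, ← MulChar.mul_apply, mul_inv_cancel,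
        MulChar.one_apply_coe, one_mul, sum_units_mulChar_mul χ fun x => ψ (a * x)]
      rfl
    simp only [Finset.sum_apply, mul_assoc, h1]
    rw [← Finset.mul_sum, Finset.sum_comm]
    simp only [← Finset.sum_mul]
    rw [eq_inv_mul_iff_mul_eq₀ hX0, Finset.mul_sum,
      ← Finset.sum_subtype (Finset.univ.filter (· ∈ H)) (by simp)
        fun x : Fˣ => (X.card : ℂ) * ψ (a * x), Finset.sum_filter]
    refine Finset.sum_congr rfl fun x _ => ?_
    split_ifs with hx
    · rw [hmem x hx]
    · rw [hnot x hx, zero_mul]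
  rw [key]
  refine (CharCombination.sum X fun χ _ => CharCombination.smul_apply _ χ⁻¹).mono ?_
  calc ∑ χ ∈ X, ‖(X.card : ℂ)⁻¹ * gaussSum χ ψ‖
      ≤ ∑ χ ∈ X, (X.card : ℝ)⁻¹ * √(Fintype.card F) := by
        refine Finset.sum_le_sum fun χ _ => ?_
        rw [norm_mul, norm_inv, Complex.norm_natCast]
        gcongr
        exact norm_gaussSum_le χ hψ
    _ = √(Fintype.card F) := by
        have : (X.card : ℝ) ≠ 0 := by exact_mod_cast hX.card_ne_zero
        simp [this]

theorem charCombination_psum {ψ : AddChar F ℂ} (hψ : ψ.IsPrimitive) (H : Subgroup Fˣ)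
    [Fintype H] (j : ℕ) :
    CharCombination (fun a : Fˣ => ∑ x : H, ψ (a * (x : Fˣ)) ^ j)
      (if ringChar F ∣ j then (Fintype.card H : ℝ) else √(Fintype.card F)) := by
  simp only [← AddChar.map_nsmul_eq_pow, nsmul_eq_mul]
  split_ifs with hj
  · rw [(ringChar.spec F j).2 hj]
    simpa using CharCombination.const (F := F) (Fintype.card H : ℂ)
  · have hj0 : (j : F) ≠ 0 := fun h => hj ((ringChar.spec F j).1 h)
    have := (charCombination_sum_subgroup hψ H).comp_mul_left (Units.mk0 _ hj0)
      fun χ => norm_mulChar_unit χ _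
    simpa [mul_assoc] using this

theorem charCombination_esymm {ψ : AddChar F ℂ} (hψ : ψ.IsPrimitive) (H : Subgroup Fˣ)
    [Fintype H] {s : ℝ} (hs : Fintype.card H ≤ ringChar F * s) (k : ℕ) :
    CharCombination
      (fun a : Fˣ => MvPolynomial.aeval (fun x : H => ψ (a * (x : Fˣ)))
        (MvPolynomial.esymm H ℂ k))
      (risingChoose (√(Fintype.card F) + s + 1) k) := by
  have hp : 0 < ringChar F := (CharP.char_is_prime F (ringChar F)).pos
  have hs0 : 0 ≤ s := by
    have : (0 : ℝ) ≤ ringChar F * s := le_trans (by positivity) hs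
    exact nonneg_of_mul_nonneg_right this (by exact_mod_cast hp)
  have hr0 := Real.sqrt_nonneg (Fintype.card F)
  induction k using Nat.strong_induction_on with
  | _ k ih =>
    rcases Nat.eq_zero_or_pos k with rfl | hk
    · simpa [risingChoose_zero] using CharCombination.const (F := F) 1
    have hk0' : (k : ℂ) ≠ 0 := by exact_mod_cast hk.ne'
    set E : ℕ → Fˣ → ℂ := fun i a => MvPolynomial.aeval (fun x : H => ψ (a * (x : Fˣ)))
        (MvPolynomial.esymm H ℂ i) with hE
    set P : ℕ → Fˣ → ℂ := fun j a => ∑ x : H, ψ (a * (x : Fˣ)) ^ j with hP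
    have newton : E k = fun a => ((k : ℂ)⁻¹ * (-1) ^ (k + 1)) *
        (∑ i ∈ Finset.range k, fun a => (-1) ^ i * (E i * P (k - i)) a) a := by
      funext a
      have h := congrArg (MvPolynomial.aeval (fun x : H => ψ (a * (x : Fˣ))))
        (MvPolynomial.mul_esymm_eq_sum H ℂ k)
      rw [Finset.sum_filter, Finset.Nat.sum_antidiagonal_eq_sum_range_succ_mk,
        Finset.sum_range_succ, if_neg (lt_irrefl _), add_zero] at h
      rw [mul_assoc, eq_inv_mul_iff_mul_eq₀ hk0']
      simp only [map_mul, map_natCast, map_pow, map_neg, map_one, map_sum] at h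
      rw [h]
      congr 1
      rw [Finset.sum_apply]
      refine Finset.sum_congr rfl fun i hi => ?_
      rw [if_pos (Finset.mem_range.1 hi)]
      simp [hE, hP, MvPolynomial.psum, mul_assoc]
    change CharCombination (E k) _
    rw [newton]
    refine ((CharCombination.sum (Finset.range k) fun i hi =>
      ((ih i (Finset.mem_range.1 hi)).mul
        (charCombination_psum hψ H (k - i))).const_mul ((-1) ^ i)).const_mul _).mono ?_
    have hle := sum_weight_mul_risingChoose_le hp hr0 hs0 hs k
    simp only [norm_mul, norm_inv, norm_pow, norm_neg, norm_one, one_pow, one_mul, mul_one,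
      Complex.norm_natCast]
    rw [inv_mul_le_iff₀ (by positivity)]
    exact hle

theorem norm_sum_addChar_mul_le [Fintype Fˣ] {ψ : AddChar F ℂ} (hψ : ψ.IsPrimitive)
    {b : F} (hb : b ≠ 0) {f : Fˣ → ℂ} {A : ℝ} (h : CharCombination f A) :
    ‖∑ a : Fˣ, ψ (a * b) * f a‖ ≤ √(Fintype.card F) * A := by
  induction h with
  | smul_apply c χ =>
    have h1 : ∑ a : Fˣ, ψ (a * b) * (c * χ a) = c * gaussSum χ (ψ.mulShift b) := by
      rw [gaussSum, ← sum_units_mulChar_mul χ, Finset.mul_sum]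
      refine Finset.sum_congr rfl fun a _ => ?_
      rw [AddChar.mulShift_apply, mul_comm b]
      ring
    rw [h1, norm_mul, mul_comm]
    gcongr
    exact norm_gaussSum_le χ (AddChar.IsPrimitive.of_ne_one (hψ hb))
  | zero => simp
  | add _ _ h₁ h₂ =>
    simp only [Pi.add_apply, mul_add, Finset.sum_add_distrib]
    exact (norm_add_le _ _).trans (add_le_add h₁ h₂)
  | mono _ h₁ h₂ => exact h₂.trans (by gcongr)

theorem card_mul_MH_eq {ψ : AddChar F ℂ} (hψ : ψ.IsPrimitive) (H : Subgroup Fˣ)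
    [Fintype H] (k : ℕ) (b : F) :
    (Fintype.card F : ℂ) * MH H k b = ∑ a : F, ψ (a * -b) *
      MvPolynomial.aeval (fun x : H => ψ (a * (x : Fˣ))) (MvPolynomial.esymm H ℂ k) := by
  classical
  let e : H ↪ F := ⟨fun x => ((x : Fˣ) : F), fun x y h => Subtype.ext (Units.ext h)⟩
  let S : Finset F := Finset.univ.map e
  have hE : ∀ a : F, MvPolynomial.aeval (fun x : H => ψ (a * (x : Fˣ)))
      (MvPolynomial.esymm H ℂ k) = ∑ t ∈ S.powersetCard k, ψ (a * ∑ x ∈ t, x) := by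
    intro a
    rw [MvPolynomial.aeval_esymm_eq_multiset_esymm]
    have : (Finset.univ : Finset H).val.map (fun x : H => ψ (a * (x : Fˣ))) =
        S.val.map fun x => ψ (a * x) := by
      simp only [S, e, Finset.map_val, Multiset.map_map]
      rfl
    rw [this, Finset.esymm_map_val]
    refine Finset.sum_congr rfl fun t _ => ?_
    rw [Finset.mul_sum]
    exact (map_prod ψ.toMonoidHom (fun x => Multiplicative.ofAdd (a * x)) t).symm
  have hM : MH H k b = ((S.powersetCard k).filter fun t => ∑ x ∈ t, x = b).card := by
    rw [MH]
    refine Nat.subtype_card _ fun t => ?_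
    have hS : ∀ x : F, x ∈ S ↔ ∃ u : Fˣ, u ∈ H ∧ (u : F) = x := fun x => by
      simp [S, show ∀ y : H, e y = (y : Fˣ) from fun _ => rfl]
    simp only [Finset.mem_filter, Finset.mem_powersetCard, Finset.subset_iff, hS]
    tauto
  have hterm : ∀ a : F, ψ (a * -b) * ∑ t ∈ S.powersetCard k, ψ (a * ∑ x ∈ t, x) =
      ∑ t ∈ S.powersetCard k, ψ (a * (-b + ∑ x ∈ t, x)) := fun a => by
    rw [Finset.mul_sum]
    simp only [mul_add, AddChar.map_add_eq_mul]
  simp only [hE, hterm]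
  rw [Finset.sum_comm]
  simp only [AddChar.sum_mulShift _ hψ, neg_add_eq_zero, eq_comm (a := b)]
  rw [hM, Finset.card_filter]
  push_cast
  rw [Finset.mul_sum]
  refine Finset.sum_congr rfl fun t _ => ?_
  split_ifs <;> simp

end FiniteField

theorem subset_sum_subgroup_estimate_ne_zero
    {F : Type*} [Field F] [Fintype F] (H : Subgroup Fˣ) (m : ℕ) (hm : H.index = m)
    (k : ℕ) (hk1 : 1 ≤ k) (hk2 : (k : ℝ) ≤ ((Fintype.card F : ℝ) - 1) / m)
    (b : F) (hb : b ≠ 0) :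
    |(MH H k b : ℝ) -
        (1 / (Fintype.card F : ℝ)) * genChoose (((Fintype.card F : ℝ) - 1) / m) k|
      ≤ (2 / Real.sqrt (Fintype.card F)) *
          genChoose (Real.sqrt (Fintype.card F) + k +
            (Fintype.card F : ℝ) / (m * ringChar F)) k := by
  classical
  let _ : Fintype H := Fintype.ofFinite H
  set q : ℝ := (Fintype.card F : ℝ) with hq
  set n := Fintype.card H with hn
  have hq0 : 0 < q := by rw [hq]; exact_mod_cast Fintype.card_pos
  have hm0 : (m : ℝ) ≠ 0 := by
    rw [← hm]; exact_mod_cast H.index_ne_zero_of_finite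
  have hmpos : (0 : ℝ) < m := lt_of_le_of_ne (by positivity) hm0.symm
  have hp : (0 : ℝ) < ringChar F := by
    exact_mod_cast (CharP.char_is_prime F (ringChar F)).pos
  have hnm : (n : ℝ) * m = q - 1 := by
    have h := H.card_mul_index
    rw [hm, Nat.card_eq_fintype_card, Nat.card_units, Nat.card_eq_fintype_card] at h
    have h1 : 1 ≤ Fintype.card F := Fintype.card_pos
    rw [hq, hn, ← Nat.cast_one, ← Nat.cast_sub h1, ← h]
    push_cast
    rfl
  have hnq : (q - 1) / m = n := by rw [← hnm]; field_simp
  have hmain : genChoose ((q - 1) / m) k = n.choose k := by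
    rw [hnq, genChoose, descPochhammer_eval_eq_descFactorial,
      Nat.descFactorial_eq_factorial_mul_choose]
    have : (k.factorial : ℝ) ≠ 0 := by positivity
    push_cast
    field_simp
  set s : ℝ := q / (m * ringChar F) with hs
  have hs0 : 0 ≤ s := by positivity
  have hns : (n : ℝ) ≤ ringChar F * s := by
    have : ringChar F * s = q / m := by rw [hs]; field_simp
    rw [this, ← hnq]
    gcongr
    linarith
  have hT : genChoose (√q + k + s) k = risingChoose (√q + s + 1) k := by
    rw [risingChoose, ← genChoose_add_sub_one]
    congr 1
    ring
  have hψ := AddChar.FiniteField.primitiveChar_to_Complex_isPrimitive F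
  set ψ := AddChar.FiniteField.primitiveChar_to_Complex F
  have hcount := card_mul_MH_eq hψ H k b
  have hbound := norm_sum_addChar_mul_le hψ (neg_ne_zero.2 hb) (charCombination_esymm hψ H hns k)
  have hE0 : MvPolynomial.aeval (fun x : H => ψ (0 * (x : Fˣ))) (MvPolynomial.esymm H ℂ k) =
      (n.choose k : ℂ) := by
    simp [MvPolynomial.esymm, hn]
  rw [sum_eq_zero_add_sum_units, hE0, zero_mul, AddChar.map_zero_eq_one, one_mul,
    ← sub_eq_iff_eq_add'] at hcount
  rw [← hcount] at hbound
  have hbound' : |q * MH H k b - n.choose k| ≤ √q * risingChoose (√q + s + 1) k := by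
    rw [← Real.norm_eq_abs, ← Complex.norm_real, hq]
    push_cast
    exact hbound
  have hT0 : 0 ≤ risingChoose (√q + s + 1) k :=
    risingChoose_nonneg (by linarith [Real.sqrt_nonneg q]) k
  rw [hmain, hT]
  have hsq : √q * √q = q := Real.mul_self_sqrt hq0.le
  have hsq0 : 0 < √q := Real.sqrt_pos.2 hq0
  calc |(MH H k b : ℝ) - 1 / q * n.choose k|
      = |q * MH H k b - n.choose k| / q := by
        rw [← abs_of_pos hq0, ← abs_div, abs_of_pos hq0]
        congr 1
        field_simp
    _ ≤ √q * risingChoose (√q + s + 1) k / q := by gcongr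
    _ = 1 / √q * risingChoose (√q + s + 1) k := by
        nth_rewrite 3 [← hsq]
        field_simp
    _ ≤ 2 / √q * risingChoose (√q + s + 1) k := by
        gcongr
        norm_num
end

section
/- Let F_q be the finite field of q elements of characteristic p, let H be a multiplicative subgroup of F_q^* of index m, and let 1 ≤ k ≤ (q-1)/m. Then |M_H(k,0) − (1/q)·C((q-1)/m, k)| ≤ C(√q + k + q/(m·p), k), where C(t,k) = t(t−1)⋯(t−k+1)/k! denotes the generalized binomial coefficient for a real number t. -/
open Finset in
/-- Averaging a monotone function over a residue class modulo `p`. -/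
theorem mul_sum_range_dvd_sub_le {B : ℕ → ℝ} (hB : Monotone B) (h0 : ∀ j, 0 ≤ B j)
    {p : ℕ} (hp : 0 < p) (k : ℕ) :
    (p : ℝ) * ∑ j ∈ range k, (if p ∣ k - j then B j else 0) ≤ ∑ j ∈ range k, B j := by
  induction k using Nat.strong_induction_on with
  | _ k ih =>
    rcases lt_or_ge k p with hk | hk
    · have hz : ∑ j ∈ range k, (if p ∣ k - j then B j else 0) = 0 := by
        refine sum_eq_zero fun j hj => if_neg fun hd => ?_
        have hj := mem_range.1 hj
        have := Nat.le_of_dvd (by omega) hd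
        omega
      rw [hz, mul_zero]
      exact sum_nonneg fun j _ => h0 j
    · obtain ⟨r, rfl⟩ := Nat.exists_eq_add_of_le' hk
      have h1 : ∑ j ∈ range r, (if p ∣ r + p - j then B j else 0) =
          ∑ j ∈ range r, (if p ∣ r - j then B j else 0) := by
        refine sum_congr rfl fun j hj => ?_
        have hj := mem_range.1 hj
        have : r + p - j = (r - j) + p := by omega
        simp only [this, Nat.dvd_add_self_right]
      have h2 : ∑ i ∈ range p, (if p ∣ r + p - (r + i) then B (r + i) else 0) = B r := by
        rw [sum_eq_single_of_mem 0 (mem_range.2 hp)]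
        · simp
        · intro i hi hi0
          have hi := mem_range.1 hi
          refine if_neg fun hd => ?_
          have := Nat.le_of_dvd (by omega) hd
          omega
      have h3 : (p : ℝ) * B r ≤ ∑ i ∈ range p, B (r + i) := by
        have := card_nsmul_le_sum (range p) (fun i => B (r + i)) (B r)
          fun i _ => hB (Nat.le_add_right r i)
        simpa using this
      rw [sum_range_add, sum_range_add, h1, h2, mul_add]
      exact add_le_add (ih r (by omega)) h3

open Finset in
theorem sum_range_ascPochhammer_div_factorial (x : ℝ) (k : ℕ) :
    x * ∑ j ∈ range k, (ascPochhammer ℝ j).eval x / j.factorial =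
      k * ((ascPochhammer ℝ k).eval x / k.factorial) := by
  induction k with
  | zero => simp
  | succ k ih =>
    rw [sum_range_succ, mul_add, ih, ascPochhammer_succ_eval, Nat.factorial_succ]
    have : (k.factorial : ℝ) ≠ 0 := by positivity
    push_cast
    field_simp
    ring

theorem ascPochhammer_div_factorial_nonneg {x : ℝ} (hx : 1 ≤ x) (k : ℕ) :
    0 ≤ (ascPochhammer ℝ k).eval x / k.factorial :=
  div_nonneg (ascPochhammer_pos k x (by linarith)).le (by positivity)

theorem monotone_ascPochhammer_div_factorial {x : ℝ} (hx : 1 ≤ x) :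
    Monotone fun k : ℕ => (ascPochhammer ℝ k).eval x / k.factorial := by
  refine monotone_nat_of_le_succ fun k => ?_
  have h := ascPochhammer_pos k x (by linarith)
  rw [ascPochhammer_succ_eval, Nat.factorial_succ, div_le_div_iff₀ (by positivity) (by positivity)]
  push_cast
  have : 0 ≤ (ascPochhammer ℝ k).eval x * k.factorial := by positivity
  nlinarith

open Finset in
/-- Power sums of size at most `s`, or `s + n` when the exponent is divisible by `p`, force
elementary symmetric functions to be bounded by rising-factorial binomials. -/
theorem norm_aeval_esymm_le {σ : Type*} [Fintype σ] (f : σ → ℂ) {p : ℕ} (hp : 0 < p)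
    {s n x : ℝ} (hn : 0 ≤ n)
    (hf : ∀ i, 0 < i → ‖∑ a, f a ^ i‖ ≤ s + if p ∣ i then n else 0)
    (hx : 1 ≤ x) (hsx : s + n / p ≤ x) (k : ℕ) :
    ‖MvPolynomial.aeval f (MvPolynomial.esymm σ ℤ k)‖ ≤
      (ascPochhammer ℝ k).eval x / k.factorial := by
  induction k using Nat.strong_induction_on with
  | _ k ih =>
    rcases Nat.eq_zero_or_pos k with rfl | hk
    · simp
    set B : ℕ → ℝ := fun j => (ascPochhammer ℝ j).eval x / j.factorial with hBdef
    have hB0 : ∀ j, 0 ≤ B j := ascPochhammer_div_factorial_nonneg hx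
    have hN := congrArg (MvPolynomial.aeval f) (MvPolynomial.mul_esymm_eq_sum σ ℤ k)
    have hN' : (k : ℂ) * MvPolynomial.aeval f (MvPolynomial.esymm σ ℤ k) =
        (-1) ^ (k + 1) * ∑ j ∈ range k,
          (-1) ^ j * MvPolynomial.aeval f (MvPolynomial.esymm σ ℤ j) * ∑ a, f a ^ (k - j) := by
      simp only [map_mul, map_natCast, map_pow, map_neg, map_one, map_sum, MvPolynomial.psum,
        sum_filter] at hN
      rw [hN, Nat.sum_antidiagonal_eq_sum_range_succ_mk, sum_range_succ]
      rw [if_neg (lt_irrefl k), map_zero, add_zero]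
      congr 1
      refine sum_congr rfl fun j hj => ?_
      rw [if_pos (mem_range.1 hj)]
      simp
    have hle : (k : ℝ) * ‖MvPolynomial.aeval f (MvPolynomial.esymm σ ℤ k)‖ ≤ k * B k := by
      calc (k : ℝ) * ‖MvPolynomial.aeval f (MvPolynomial.esymm σ ℤ k)‖
          = ‖(k : ℂ) * MvPolynomial.aeval f (MvPolynomial.esymm σ ℤ k)‖ := by simp
        _ = ‖∑ j ∈ range k, (-1) ^ j * MvPolynomial.aeval f (MvPolynomial.esymm σ ℤ j) *
              ∑ a, f a ^ (k - j)‖ := by rw [hN']; simp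
        _ ≤ ∑ j ∈ range k, B j * (s + if p ∣ k - j then n else 0) := by
            refine (norm_sum_le _ _).trans (sum_le_sum fun j hj => ?_)
            have hj := mem_range.1 hj
            rw [norm_mul, norm_mul, norm_pow, norm_neg, norm_one, one_pow, one_mul]
            exact mul_le_mul (ih j hj) (hf _ (by omega)) (norm_nonneg _) (hB0 j)
        _ = s * ∑ j ∈ range k, B j + n * ∑ j ∈ range k, (if p ∣ k - j then B j else 0) := by
            rw [mul_sum, mul_sum, ← sum_add_distrib]
            refine sum_congr rfl fun j _ => ?_
            split_ifs <;> ring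
        _ ≤ s * ∑ j ∈ range k, B j + n * ((∑ j ∈ range k, B j) / p) := by
            gcongr
            rw [le_div_iff₀' (by positivity)]
            exact mul_sum_range_dvd_sub_le (monotone_ascPochhammer_div_factorial hx) hB0 hp k
        _ = (s + n / p) * ∑ j ∈ range k, B j := by ring
        _ ≤ x * ∑ j ∈ range k, B j :=
            mul_le_mul_of_nonneg_right hsx (sum_nonneg fun j _ => hB0 j)
        _ = k * B k := sum_range_ascPochhammer_div_factorial x k
    exact le_of_mul_le_mul_left hle (by positivity)

open Finset in
/-- Nontrivial additive character sums over a multiplicative subgroup are at most `√q`. -/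
theorem norm_sum_subgroup_addChar_le {F : Type*} [Field F] [Fintype F] (H : Subgroup Fˣ)
    [Fintype H] {ψ : AddChar F ℂ} (hψ : ψ.IsPrimitive) {a : F} (ha : a ≠ 0) :
    ‖∑ u : H, ψ (a * ((u : Fˣ) : F))‖ ≤ Real.sqrt (Fintype.card F) := by
  classical
  set T : F → ℂ := fun b => ∑ u : H, ψ (b * ((u : Fˣ) : F)) with hT
  have hsumC : ∑ b, ((‖T b‖ ^ 2 : ℝ) : ℂ) = Fintype.card F * Fintype.card H := by
    have h1 : ∀ b, ((‖T b‖ ^ 2 : ℝ) : ℂ) =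
        ∑ u : H, ∑ v : H, ψ (b * (((u : Fˣ) : F) - ((v : Fˣ) : F))) := by
      intro b
      push_cast
      rw [← Complex.mul_conj', hT, map_sum, sum_mul_sum]
      refine sum_congr rfl fun u _ => sum_congr rfl fun v _ => ?_
      rw [← AddChar.map_neg_eq_conj, ← AddChar.map_add_eq_mul]
      congr 1
      ring
    simp_rw [h1]
    rw [sum_comm]
    have h2 : ∀ u : H, ∑ b : F, ∑ v : H, ψ (b * (((u : Fˣ) : F) - ((v : Fˣ) : F))) =
        Fintype.card F := by
      intro u
      rw [sum_comm]
      simp_rw [AddChar.sum_mulShift _ hψ, sub_eq_zero, Units.val_inj, Subtype.val_inj]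
      simp
    simp [h2, mul_comm]
  have hsum : ∑ b, ‖T b‖ ^ 2 = (Fintype.card F * Fintype.card H : ℝ) := by
    exact_mod_cast hsumC
  have hinv : ∀ v : H, T (a * ((v : Fˣ) : F)) = T a := by
    intro v
    refine Fintype.sum_equiv (Equiv.mulLeft v) _ _ fun u => ?_
    simp [mul_assoc]
  have hinj : Function.Injective fun v : H => a * ((v : Fˣ) : F) := by
    intro u v h
    exact Subtype.ext (Units.ext (mul_left_cancel₀ ha h))
  have hle : (Fintype.card H : ℝ) * ‖T a‖ ^ 2 ≤ Fintype.card F * Fintype.card H := by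
    calc (Fintype.card H : ℝ) * ‖T a‖ ^ 2 = ∑ v : H, ‖T (a * ((v : Fˣ) : F))‖ ^ 2 := by
          simp [hinv]
      _ = ∑ b ∈ univ.image fun v : H => a * ((v : Fˣ) : F), ‖T b‖ ^ 2 :=
          (sum_image (f := fun b => ‖T b‖ ^ 2) hinj.injOn).symm
      _ ≤ ∑ b, ‖T b‖ ^ 2 :=
          sum_le_sum_of_subset_of_nonneg (subset_univ _) fun b _ _ => sq_nonneg _
      _ = _ := hsum
  have hpos : (0 : ℝ) < Fintype.card H := by exact_mod_cast Fintype.card_pos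
  exact Real.le_sqrt_of_sq_le (by nlinarith)

open Finset in
theorem MH_eq_card_filter {F : Type*} [Field F] [DecidableEq F] (H : Subgroup Fˣ) [Fintype H]
    (k : ℕ) (b : F) :
    MH H k b = #((powersetCard k (univ : Finset H)).filter fun t : Finset H => ∑ u ∈ t, ((u : Fˣ) : F) = b) := by
  classical
  let e : H ↪ F := ⟨fun u => ((u : Fˣ) : F), fun u v h => Subtype.ext (Units.ext h)⟩
  have hmap : ∀ S : Finset F, (∀ x ∈ S, ∃ u : Fˣ, u ∈ H ∧ (u : F) = x) →
      ∃ t : Finset H, t.map e = S := by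
    intro S hS
    refine ⟨S.preimage e e.injective.injOn, ?_⟩
    ext x
    simp only [mem_map, mem_preimage]
    constructor
    · rintro ⟨u, hu, rfl⟩
      exact hu
    · intro hx
      obtain ⟨u, hu, rfl⟩ := hS x hx
      exact ⟨⟨u, hu⟩, hx, rfl⟩
  have hmem : ∀ t ∈ (powersetCard k (univ : Finset H)).filter
      fun t : Finset H => ∑ u ∈ t, ((u : Fˣ) : F) = b,
      #(t.map e) = k ∧ (∀ x ∈ t.map e, ∃ u : Fˣ, u ∈ H ∧ (u : F) = x) ∧
        ∑ x ∈ t.map e, x = b := by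
    intro t ht
    rw [mem_filter, mem_powersetCard] at ht
    refine ⟨by rw [card_map, ht.1.2], fun x hx => ?_, by rw [sum_map]; exact ht.2⟩
    obtain ⟨u, -, rfl⟩ := mem_map.1 hx
    exact ⟨u, u.2, rfl⟩
  rw [MH, ← Nat.card_eq_finsetCard]
  refine (Nat.card_congr (Equiv.ofBijective (fun t => ⟨t.1.map e, hmem t.1 t.2⟩) ⟨?_, ?_⟩)).symm
  · intro t t' h
    exact Subtype.ext (map_injective e (Subtype.ext_iff.1 h))
  · rintro ⟨S, hk, hS, hb⟩
    obtain ⟨t, rfl⟩ := hmap S hS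
    refine ⟨⟨t, mem_filter.2 ⟨mem_powersetCard.2 ⟨subset_univ _, by rwa [card_map] at hk⟩, ?_⟩⟩,
      rfl⟩
    rw [sum_map] at hb
    exact hb

open Finset in
/-- Counting subset sums by orthogonality of additive characters. -/
theorem card_mul_MH_zero {F : Type*} [Field F] [Fintype F] (H : Subgroup Fˣ) [Fintype H]
    {ψ : AddChar F ℂ} (hψ : ψ.IsPrimitive) (k : ℕ) :
    (Fintype.card F : ℂ) * MH H k (0 : F) =
      ∑ a : F, MvPolynomial.aeval (fun u : H => ψ (a * ((u : Fˣ) : F)))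
        (MvPolynomial.esymm H ℤ k) := by
  classical
  have h1 : ∀ a : F, MvPolynomial.aeval (fun u : H => ψ (a * ((u : Fˣ) : F)))
        (MvPolynomial.esymm H ℤ k) =
      ∑ t ∈ powersetCard k (univ : Finset H), ψ (a * ∑ u ∈ t, ((u : Fˣ) : F)) := by
    intro a
    simp only [MvPolynomial.esymm, map_sum, map_prod, MvPolynomial.aeval_X]
    refine sum_congr rfl fun t ht => ?_
    clear ht
    rw [mul_sum]
    induction t using Finset.induction_on with
    | empty => simp
    | insert i t hi ih => rw [prod_insert hi, sum_insert hi, AddChar.map_add_eq_mul, ih]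
  simp_rw [h1]
  rw [sum_comm]
  simp_rw [AddChar.sum_mulShift _ hψ]
  rw [MH_eq_card_filter, card_filter]
  push_cast
  rw [mul_sum]
  refine sum_congr rfl fun t _ => ?_
  split_ifs <;> simp

theorem subset_sum_subgroup_estimate_zero
    {F : Type*} [Field F] [Fintype F] (H : Subgroup Fˣ) (m : ℕ) (hm : H.index = m)
    (k : ℕ) (hk1 : 1 ≤ k) (hk2 : (k : ℝ) ≤ ((Fintype.card F : ℝ) - 1) / m) :
    |(MH H k (0 : F) : ℝ) -
        (1 / (Fintype.card F : ℝ)) * genChoose (((Fintype.card F : ℝ) - 1) / m) k|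
      ≤ genChoose (Real.sqrt (Fintype.card F) + k +
          (Fintype.card F : ℝ) / (m * ringChar F)) k := by
  classical
  have : Fintype H := Fintype.ofFinite H
  obtain ⟨ψ, hψ1⟩ := AddChar.exists_apply_ne_zero.2 (one_ne_zero : (1 : F) ≠ 0)
  have hψ : ψ.IsPrimitive := AddChar.IsPrimitive.of_ne_one fun h => hψ1 (by simp [h])
  have hp : 0 < ringChar F :=
    Nat.pos_of_ne_zero (CharP.char_ne_zero_of_finite F (ringChar F))
  have hm0 : 0 < m := hm ▸ Nat.pos_of_ne_zero Subgroup.index_ne_zero_of_finite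
  set q : ℝ := (Fintype.card F : ℝ) with hq
  have hq1 : 1 ≤ q := Nat.one_le_cast.2 (Fintype.card_pos (α := F))
  have hcard : (Fintype.card H : ℝ) = (q - 1) / m := by
    have h := H.card_mul_index
    rw [hm, Nat.card_eq_fintype_card, Nat.card_eq_fintype_card, Fintype.card_units] at h
    rw [eq_div_iff (by positivity)]
    have h' : Fintype.card H * m + 1 = Fintype.card F := by
      have := Fintype.card_pos (α := F)
      omega
    have h'' : (Fintype.card H : ℝ) * m + 1 = q := by rw [hq]; exact_mod_cast h'
    linarith
  set E : F → ℂ := fun a => MvPolynomial.aeval (fun u : H => ψ (a * ((u : Fˣ) : F)))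
    (MvPolynomial.esymm H ℤ k) with hE
  set R : ℝ := genChoose (Real.sqrt q + k + q / (m * ringChar F)) k with hR
  have hRasc : R = (ascPochhammer ℝ k).eval (Real.sqrt q + q / (m * ringChar F) + 1) /
      k.factorial := by
    rw [hR, genChoose, descPochhammer_eval_eq_ascPochhammer]
    congr 2
    ring
  have hsqrt : 1 ≤ Real.sqrt q := Real.one_le_sqrt.2 hq1
  have hquot : 0 ≤ q / (m * ringChar F) := by positivity
  have hx : 1 ≤ Real.sqrt q + q / (m * ringChar F) + 1 := by linarith
  have hR0 : 0 ≤ R := hRasc ▸ ascPochhammer_div_factorial_nonneg hx k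
  have hEle : ∀ a ≠ 0, ‖E a‖ ≤ R := by
    intro a ha
    rw [hRasc]
    refine norm_aeval_esymm_le _ hp (s := Real.sqrt q) (n := Fintype.card H) (by positivity)
      (fun i _ => ?_) hx ?_ k
    · have hpow : ∀ u : H, ψ (a * ((u : Fˣ) : F)) ^ i = ψ (a * i * ((u : Fˣ) : F)) := by
        intro u
        rw [← AddChar.map_nsmul_eq_pow, nsmul_eq_mul]
        congr 1
        ring
      simp_rw [hpow]
      split_ifs with hd
      · refine (norm_sum_le _ _).trans ?_
        simp only [AddChar.norm_apply, Finset.sum_const, Finset.card_univ, nsmul_eq_mul, mul_one]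
        linarith
      · rw [add_zero]
        exact norm_sum_subgroup_addChar_le H hψ
          (mul_ne_zero ha fun h => hd ((ringChar.spec F i).1 h))
    · have : (Fintype.card H : ℝ) / ringChar F ≤ q / (m * ringChar F) := by
        rw [hcard, div_div]
        gcongr
        linarith
      linarith
  have hE0 : E 0 = genChoose ((q - 1) / m) k := by
    rw [← hcard, genChoose, ← Nat.cast_choose_eq_descPochhammer_div]
    simp [hE, MvPolynomial.esymm]
  have hmain : (q : ℂ) * (((MH H k (0 : F) : ℝ) - 1 / q * genChoose ((q - 1) / m) k : ℝ) : ℂ) =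
      ∑ a ∈ Finset.univ.erase 0, E a := by
    have h := card_mul_MH_zero H hψ k
    rw [← Finset.add_sum_erase _ _ (Finset.mem_univ (0 : F))] at h
    change _ = E 0 + ∑ a ∈ Finset.univ.erase 0, E a at h
    rw [hE0] at h
    have hqC : (q : ℂ) ≠ 0 := by
      exact_mod_cast (by linarith : q ≠ 0)
    have hqq : (q : ℂ) = Fintype.card F := by simp [hq]
    rw [← hqq] at h
    push_cast
    rw [mul_sub, h]
    field_simp
    ring
  have hbound : q * |(MH H k (0 : F) : ℝ) - 1 / q * genChoose ((q - 1) / m) k| ≤ q * R := by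
    calc q * |(MH H k (0 : F) : ℝ) - 1 / q * genChoose ((q - 1) / m) k|
        = ‖∑ a ∈ Finset.univ.erase 0, E a‖ := by
          rw [← hmain, norm_mul, Complex.norm_real, Complex.norm_real, Real.norm_eq_abs,
            Real.norm_eq_abs, abs_of_nonneg (by linarith : 0 ≤ q)]
      _ ≤ ∑ a ∈ Finset.univ.erase (0 : F), R :=
          (norm_sum_le _ _).trans
            (Finset.sum_le_sum fun a ha => hEle a (Finset.ne_of_mem_erase ha))
      _ ≤ ∑ a : F, R :=
          Finset.sum_le_sum_of_subset_of_nonneg (Finset.erase_subset _ _) fun _ _ _ => hR0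
      _ = q * R := by simp [hq]
  exact le_of_mul_le_mul_left hbound (by linarith)
end

section
/- Let F_q be the finite field of q elements of characteristic p, let m be a positive divisor of q−1, let 0 ≤ k ≤ q−1, and let b ∈ F_q with b ≠ 0. Then |N_m^*(k,b) − (q−1)_k / q| ≤ (2/√q)·(m√q + k + q/p)_k, where (t)_k = t(t−1)⋯(t−k+1) denotes the falling factorial of a real number t. -/
/-- `Nstar m k b` is the number of ordered `k`-tuples of pairwise distinct nonzero
elements `x₁, …, x_k` of `F` with `x₁^m + ⋯ + x_k^m = b`. -/
noncomputable def Nstar {F : Type*} [Field F] (m k : ℕ) (b : F) : ℕ :=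
  Nat.card {x : Fin k → F //
    Function.Injective x ∧ (∀ i, x i ≠ 0) ∧ ∑ i, x i ^ m = b}

/-- The falling factorial `(t)_k = t(t-1)⋯(t-k+1)` of a real number `t`. -/
noncomputable def fallingFactorial (t : ℝ) (k : ℕ) : ℝ :=
  (descPochhammer ℝ k).eval t

namespace DiagonalDistinct

open Finset

section Real

theorem mul_sum_range_ite_dvd_le {h : ℕ → ℝ} (hmono : Monotone h) (h0 : ∀ n, 0 ≤ h n)
    {p : ℕ} (hp : 0 < p) (k : ℕ) :
    p * ∑ i ∈ range k, (if p ∣ k - i then h i else 0) ≤ ∑ i ∈ range k, h i := by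
  induction k using Nat.strong_induction_on with
  | _ k ih =>
    rcases lt_or_ge k p with hk | hk
    · have : ∑ i ∈ range k, (if p ∣ k - i then h i else 0) = 0 :=
        Finset.sum_eq_zero fun i hi ↦ if_neg fun hd ↦ by
          have := Nat.le_of_dvd (Nat.sub_pos_of_lt (Finset.mem_range.mp hi)) hd
          omega
      rw [this, mul_zero]
      exact Finset.sum_nonneg fun i _ ↦ h0 i
    · obtain ⟨n, rfl⟩ := Nat.exists_eq_add_of_le' hk
      rw [Finset.sum_range_add, Finset.sum_range_add, mul_add]
      refine add_le_add ?_ ?_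
      · have hshift : ∑ i ∈ range n, (if p ∣ n + p - i then h i else 0) =
            ∑ i ∈ range n, (if p ∣ n - i then h i else 0) := by
          refine Finset.sum_congr rfl fun i hi ↦ ?_
          have : n + p - i = n - i + p := by grind
          simp only [this, Nat.dvd_add_self_right]
        rw [hshift]
        exact ih n (by omega)
      · calc _ = (p : ℝ) * h n := by
              congr 1
              rw [Finset.sum_eq_single_of_mem 0 (by simpa using hp)]
              · simp
              · intro j hj hj0
                refine if_neg fun hd ↦ ?_
                have hj := Finset.mem_range.mp hj
                have := Nat.le_of_dvd (by omega) hd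
                omega
          _ = ∑ _j ∈ range p, h n := by simp
          _ ≤ _ := Finset.sum_le_sum fun j _ ↦ hmono (by omega)

/-- The coefficient of `u ^ k` in `(1 - u) ^ (-t)`. -/
noncomputable def risingCoeff (t : ℝ) (k : ℕ) : ℝ :=
  (ascPochhammer ℝ k).eval t / k.factorial

theorem risingCoeff_succ (t : ℝ) (k : ℕ) :
    (k + 1) * risingCoeff t (k + 1) = (t + k) * risingCoeff t k := by
  have : (k.factorial : ℝ) ≠ 0 := by positivity
  simp only [risingCoeff, ascPochhammer_succ_eval, Nat.factorial_succ]
  push_cast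
  field_simp

theorem mul_risingCoeff (t : ℝ) (k : ℕ) :
    k * risingCoeff t k = t * ∑ i ∈ range k, risingCoeff t i := by
  induction k with
  | zero => simp
  | succ k ih =>
    rw [Finset.sum_range_succ, mul_add, ← ih, Nat.cast_succ, risingCoeff_succ]
    ring

theorem risingCoeff_nonneg {t : ℝ} (ht : 1 ≤ t) (k : ℕ) : 0 ≤ risingCoeff t k :=
  div_nonneg (ascPochhammer_pos k t (by linarith)).le (by positivity)

theorem risingCoeff_monotone {t : ℝ} (ht : 1 ≤ t) : Monotone (risingCoeff t) := by
  refine monotone_nat_of_le_succ fun k ↦ ?_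
  have h := risingCoeff_succ t k
  have h0 := risingCoeff_nonneg ht k
  have hk : (0 : ℝ) < k + 1 := by positivity
  refine le_of_mul_le_mul_left ?_ hk
  rw [h]
  exact mul_le_mul_of_nonneg_right (by linarith) h0

theorem sum_range_weight_mul_risingCoeff_le {A s : ℝ} (hA : 0 ≤ A) (hs : 0 ≤ s)
    {p : ℕ} (hp : 0 < p) (k : ℕ) :
    ∑ i ∈ range k, (A + if p ∣ k - i then p * s else 0) * risingCoeff (A + s + 1) i ≤
      k * risingCoeff (A + s + 1) k := by
  have ht : 1 ≤ A + s + 1 := by linarith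
  have h1 := mul_sum_range_ite_dvd_le (risingCoeff_monotone ht) (risingCoeff_nonneg ht) hp k
  have h2 : 0 ≤ ∑ i ∈ range k, risingCoeff (A + s + 1) i :=
    Finset.sum_nonneg fun i _ ↦ risingCoeff_nonneg ht i
  calc _ = A * ∑ i ∈ range k, risingCoeff (A + s + 1) i +
        s * (p * ∑ i ∈ range k, if p ∣ k - i then risingCoeff (A + s + 1) i else 0) := by
        simp only [Finset.mul_sum, ← Finset.sum_add_distrib]
        refine Finset.sum_congr rfl fun i _ ↦ ?_
        split_ifs <;> ring
    _ ≤ A * ∑ i ∈ range k, risingCoeff (A + s + 1) i +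
        s * ∑ i ∈ range k, risingCoeff (A + s + 1) i := by gcongr
    _ ≤ _ := by rw [mul_risingCoeff]; linarith

end Real

section Symmetric

variable {σ : Type*} [Fintype σ]

/-- Newton's identities for the elementary symmetric functions of a finite family. -/
theorem mul_sum_powersetCard_prod {R : Type*} [CommRing R] (f : σ → R) (k : ℕ) :
    k * ∑ s ∈ powersetCard k univ, ∏ i ∈ s, f i =
      (-1) ^ (k + 1) * ∑ a ∈ antidiagonal k with a.1 < k,
        (-1) ^ a.1 * (∑ s ∈ powersetCard a.1 univ, ∏ i ∈ s, f i) * ∑ x, f x ^ a.2 := by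
  simpa [MvPolynomial.esymm, MvPolynomial.psum] using
    congrArg (MvPolynomial.aeval f) (MvPolynomial.mul_esymm_eq_sum σ R k)

variable [DecidableEq σ]

theorem card_filter_map_univ_eq {k : ℕ} {s : Finset σ} (hs : #s = k) :
    #{e : Fin k ↪ σ | univ.map e = s} = k.factorial := by
  have : ({e : Fin k ↪ σ | univ.map e = s} : Finset (Fin k ↪ σ)) =
      (univ : Finset (Fin k ↪ s)).map
        ⟨fun e ↦ e.trans (.subtype _), fun e e' h ↦ by
          ext i; exact DFunLike.congr_fun h i⟩ := by
    ext e
    simp only [mem_filter, mem_univ, true_and, mem_map]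
    constructor
    · rintro rfl
      exact ⟨⟨fun i ↦ ⟨e i, by simp⟩, fun i j h ↦ e.injective (congrArg Subtype.val h)⟩, rfl⟩
    · rintro ⟨e, rfl⟩
      refine Finset.eq_of_subset_of_card_le ?_ (by simp [hs])
      intro x hx
      obtain ⟨i, -, rfl⟩ := Finset.mem_map.mp hx
      exact (e i).2
  rw [this, Finset.card_map, Finset.card_univ, Fintype.card_embedding_eq, Fintype.card_coe, hs,
    Fintype.card_fin, Nat.descFactorial_self]

theorem sum_embedding_prod {R : Type*} [CommRing R] (f : σ → R) (k : ℕ) :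
    ∑ e : Fin k ↪ σ, ∏ i, f (e i) =
      k.factorial * ∑ s ∈ powersetCard k univ, ∏ i ∈ s, f i := by
  rw [← Finset.sum_fiberwise_of_maps_to (t := powersetCard k univ) (g := fun e ↦ univ.map e)
    (fun e _ ↦ by simp [mem_powersetCard]), Finset.mul_sum]
  refine Finset.sum_congr rfl fun s hs ↦ ?_
  rw [← card_filter_map_univ_eq (mem_powersetCard.mp hs).2, ← nsmul_eq_mul, ← Finset.sum_const]
  refine Finset.sum_congr rfl fun e he ↦ ?_
  rw [← (mem_filter.mp he).2, Finset.prod_map]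

end Symmetric

section Field

variable {F : Type*} [Field F] [Fintype F]

theorem card_mulChar_pow_eq_one_le [DecidableEq (MulChar F ℂ)] [Fintype (MulChar F ℂ)]
    {m : ℕ} (hm : 0 < m) : #{χ : MulChar F ℂ | χ ^ m = 1} ≤ m := by
  classical
  obtain ⟨e⟩ := MulChar.mulEquiv_units F ℂ
  have : IsCyclic (MulChar F ℂ) := isCyclic_of_surjective e.symm e.symm.surjective
  exact IsCyclic.card_pow_eq_one_le hm

theorem norm_gaussSum_le (χ : MulChar F ℂ) {ψ : AddChar F ℂ} (hψ : ψ.IsPrimitive) :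
    ‖gaussSum χ ψ‖ ≤ √(Fintype.card F) := by
  apply Real.le_sqrt_of_sq_le
  rcases eq_or_ne χ 1 with rfl | hχ
  · have : ψ ≠ 1 := by simpa using hψ one_ne_zero
    rw [gaussSum_one_left this]
    simpa using Nat.one_le_iff_ne_zero.mpr (Fintype.card_ne_zero (α := F))
  · have h := gaussSum_mul_gaussSum_eq_card hχ hψ
    rw [← star_gaussSum_eq] at h
    have := congrArg norm h
    rw [norm_mul, norm_star] at this
    simp only [norm_natCast] at this
    rw [sq, this]

variable [DecidableEq F]

/-- Orthogonality of the multiplicative characters of a finite field, in the character variable. -/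
theorem sum_mulChar_apply [Fintype (MulChar F ℂ)] (a : F) :
    ∑ χ : MulChar F ℂ, χ a = if a = 1 then (Fintype.card Fˣ : ℂ) else 0 := by
  split_ifs with ha
  · have := MulChar.card_eq_card_units_of_hasEnoughRootsOfUnity F ℂ
    rw [Nat.card_eq_fintype_card, Nat.card_eq_fintype_card] at this
    simp [ha, this]
  · obtain ⟨χ, hχ⟩ := MulChar.exists_apply_ne_one_of_hasEnoughRootsOfUnity F ℂ ha
    refine eq_zero_of_mul_eq_self_left hχ ?_
    simp only [Finset.mul_sum, ← MulChar.mul_apply]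
    exact Fintype.sum_bijective _ (Group.mulLeft_bijective χ) _ _ fun χ' ↦ rfl

/-- Fourier inversion for an additive character restricted to the multiplicative group. -/
theorem card_units_mul_addChar_apply [Fintype (MulChar F ℂ)] (ψ : AddChar F ℂ) (y : Fˣ) :
    (Fintype.card Fˣ : ℂ) * ψ y = ∑ χ : MulChar F ℂ, χ⁻¹ y * gaussSum χ ψ := by
  classical
  simp only [gaussSum, Finset.mul_sum]
  rw [Finset.sum_comm]
  have h (a : F) : ∑ χ : MulChar F ℂ, χ⁻¹ y * (χ a * ψ a)
      = (if a = y then (Fintype.card Fˣ : ℂ) else 0) * ψ a := by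
    have := sum_mulChar_apply ((y : F)⁻¹ * a)
    simp only [inv_mul_eq_one₀ y.ne_zero, map_mul] at this
    simp only [@eq_comm _ a, ← this, Finset.sum_mul, MulChar.inv_apply', mul_assoc]
  simp [h]

theorem sum_units_mulChar_eq_zero {χ : MulChar F ℂ} (hχ : χ ≠ 1) : ∑ x : Fˣ, χ x = 0 := by
  obtain ⟨b, hb⟩ := MulChar.ne_one_iff.mp hχ
  refine eq_zero_of_mul_eq_self_left hb ?_
  simpa only [Finset.mul_sum, ← map_mul, Units.val_mul] using
    (Group.mulLeft_bijective b).sum_comp fun x : Fˣ ↦ χ x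

theorem norm_mulChar_apply_le (χ : MulChar F ℂ) (a : F) : ‖χ a‖ ≤ 1 := by
  by_cases ha : IsUnit a
  · obtain ⟨u, rfl⟩ := ha
    have h : χ u ^ Fintype.card Fˣ = 1 := by
      rw [← map_pow, ← Units.val_pow_eq_pow_val, pow_card_eq_one]; simp
    exact (Complex.norm_eq_one_of_pow_eq_one h Fintype.card_ne_zero).le
  · simp [χ.map_nonunit ha]

theorem sum_units_addChar_pow [DecidableEq (MulChar F ℂ)] [Fintype (MulChar F ℂ)]
    (ψ : AddChar F ℂ) (m : ℕ) (a : Fˣ) :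
    ∑ x : Fˣ, ψ (a * (x : F) ^ m) =
      ∑ χ : MulChar F ℂ with χ ^ m = 1, χ⁻¹ a * gaussSum χ ψ := by
  classical
  have hc : (Fintype.card Fˣ : ℂ) ≠ 0 := by exact_mod_cast Fintype.card_ne_zero
  apply mul_left_cancel₀ hc
  have h (χ : MulChar F ℂ) : ∑ x : Fˣ, χ⁻¹ ((x : F) ^ m) =
      if χ ^ m = 1 then (Fintype.card Fˣ : ℂ) else 0 := by
    split_ifs with hχ
    · have : (χ⁻¹) ^ m = 1 := by rw [inv_pow, hχ, inv_one]
      have (x : Fˣ) : χ⁻¹ ((x : F) ^ m) = 1 := by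
        rw [map_pow, ← MulChar.pow_apply_coe, this, MulChar.one_apply_coe]
      simp [this]
    · have h1 : (χ⁻¹) ^ m ≠ 1 := by rwa [inv_pow, ne_eq, inv_eq_one]
      simpa only [MulChar.pow_apply_coe, map_pow] using sum_units_mulChar_eq_zero h1
  calc _ = ∑ x : Fˣ, ∑ χ : MulChar F ℂ, χ⁻¹ a * χ⁻¹ ((x : F) ^ m) * gaussSum χ ψ := by
        rw [Finset.mul_sum]
        refine Finset.sum_congr rfl fun x _ ↦ ?_
        have := card_units_mul_addChar_apply ψ (a * x ^ m)
        push_cast at this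
        simpa using this
    _ = _ := by
        rw [Finset.sum_comm]
        simp_rw [← Finset.sum_mul, ← Finset.mul_sum, h]
        rw [Finset.sum_filter, Finset.mul_sum]
        refine Finset.sum_congr rfl fun χ _ ↦ ?_
        split_ifs <;> ring


/-- Multiplying by the power sum `∑ x, ψ (a x ^ m) ^ j` increases a uniform bound for twisted
sums by a factor at most `m √q`, or `m √q + q` when the characteristic divides `j`. -/
theorem norm_sum_mulChar_mul_powerSum_le {φ ψ : AddChar F ℂ} (hψ : ψ.IsPrimitive)
    {m : ℕ} (hm : 0 < m) (j : ℕ) {G : F → ℂ} {B : ℝ}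
    (hG : ∀ χ : MulChar F ℂ, ‖∑ a, χ a * φ a * G a‖ ≤ B) (χ : MulChar F ℂ) :
    ‖∑ a, χ a * φ a * (G a * ∑ x : Fˣ, ψ (a * (x : F) ^ m) ^ j)‖ ≤
      (m * √(Fintype.card F) + if ringChar F ∣ j then (Fintype.card F : ℝ) else 0) * B := by
  classical
  have := Fintype.ofFinite (MulChar F ℂ)
  have hB : 0 ≤ B := (norm_nonneg _).trans (hG 1)
  have hpow (a : F) (x : Fˣ) : ψ (a * (x : F) ^ m) ^ j = ψ (j * a * (x : F) ^ m) := by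
    rw [← AddChar.map_nsmul_eq_pow, nsmul_eq_mul, mul_assoc]
  simp_rw [hpow]
  split_ifs with hj
  · have hj0 : (j : F) = 0 := (ringChar.spec F j).mpr hj
    have : ∑ a, χ a * φ a * (G a * ∑ x : Fˣ, ψ (j * a * (x : F) ^ m)) =
        Fintype.card Fˣ * ∑ a, χ a * φ a * G a := by
      rw [Finset.mul_sum]
      refine Finset.sum_congr rfl fun a _ ↦ ?_
      simp only [hj0, zero_mul, AddChar.map_zero_eq_one, Finset.sum_const, Finset.card_univ,
        nsmul_eq_mul]
      ring
    rw [this, norm_mul, Complex.norm_natCast]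
    have hcard : (Fintype.card Fˣ : ℝ) ≤ Fintype.card F := by
      exact_mod_cast Fintype.card_le_of_injective _ Units.val_injective
    refine mul_le_mul (hcard.trans ?_) (hG χ) (norm_nonneg _) (by positivity)
    exact le_add_of_nonneg_left (by positivity)
  · have hj0 : (j : F) ≠ 0 := fun h ↦ hj ((ringChar.spec F j).mp h)
    have : ∑ a, χ a * φ a * (G a * ∑ x : Fˣ, ψ (j * a * (x : F) ^ m)) =
        ∑ η : MulChar F ℂ with η ^ m = 1,
          η⁻¹ j * gaussSum η ψ * ∑ a, (χ * η⁻¹) a * φ a * G a := by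
      conv_rhs => simp only [Finset.mul_sum]
      rw [Finset.sum_comm]
      refine Finset.sum_congr rfl fun a _ ↦ ?_
      rcases eq_or_ne a 0 with rfl | ha
      · simp [MulChar.map_zero]
      · have := sum_units_addChar_pow ψ m (Units.mk0 (j * a) (mul_ne_zero hj0 ha))
        simp only [Units.val_mk0] at this
        rw [this, Finset.mul_sum, Finset.mul_sum]
        refine Finset.sum_congr rfl fun η _ ↦ ?_
        rw [map_mul, MulChar.mul_apply]
        ring
    rw [this, add_zero]
    calc _ ≤ ∑ η : MulChar F ℂ with η ^ m = 1, √(Fintype.card F) * B := by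
          refine norm_sum_le_of_le _ fun η _ ↦ ?_
          rw [norm_mul, norm_mul]
          refine mul_le_mul ?_ (hG _) (norm_nonneg _) (by positivity)
          calc _ ≤ 1 * √(Fintype.card F : ℝ) :=
                mul_le_mul (norm_mulChar_apply_le _ _) (norm_gaussSum_le η hψ)
                  (norm_nonneg _) zero_le_one
            _ = _ := one_mul _
      _ ≤ _ := by
          rw [Finset.sum_const, nsmul_eq_mul, mul_assoc]
          gcongr
          exact card_mulChar_pow_eq_one_le hm

end Field

section Estimate

theorem addChar_sum_eq_prod {A M ι : Type*} [AddCommMonoid A] [CommMonoid M] (ψ : AddChar A M)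
    (s : Finset ι) (f : ι → A) :
    ψ (∑ i ∈ s, f i) = ∏ i ∈ s, ψ (f i) := by
  induction s using Finset.cons_induction with
  | empty => simp
  | cons i s hi ih => rw [Finset.sum_cons, Finset.prod_cons, AddChar.map_add_eq_mul, ih]

variable {F : Type*} [Field F] [Fintype F] [DecidableEq F]

theorem norm_sum_mulChar_mul_esymm_le {φ ψ : AddChar F ℂ} (hφ : φ.IsPrimitive)
    (hψ : ψ.IsPrimitive) {m : ℕ} (hm : 0 < m) (k : ℕ) (χ : MulChar F ℂ) :
    ‖∑ a, χ a * φ a * ∑ s ∈ powersetCard k univ, ∏ x ∈ s, ψ (a * ((x : Fˣ) : F) ^ m)‖ ≤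
      risingCoeff (m * √(Fintype.card F) + (Fintype.card F : ℝ) / ringChar F + 1) k *
        √(Fintype.card F) := by
  induction k using Nat.strong_induction_on generalizing χ with
  | _ k ih =>
    rcases Nat.eq_zero_or_pos k with rfl | hk
    · simpa [risingCoeff, gaussSum] using norm_gaussSum_le χ hφ
    set q : ℝ := (Fintype.card F : ℝ) with hq
    have hp : 0 < ringChar F := Nat.pos_of_ne_zero (CharP.ringChar_ne_zero_of_finite F)
    have hpq : (ringChar F : ℝ) * (q / ringChar F) = q :=
      mul_div_cancel₀ _ (by exact_mod_cast hp.ne')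
    have hweight := sum_range_weight_mul_risingCoeff_le (A := m * √q) (s := q / ringChar F)
      (by positivity) (by positivity) hp k
    rw [hpq] at hweight
    refine le_of_mul_le_mul_left ?_ (Nat.cast_pos.mpr hk : (0 : ℝ) < k)
    set e : ℕ → F → ℂ := fun n a ↦
      ∑ s ∈ powersetCard n univ, ∏ x ∈ s, ψ (a * ((x : Fˣ) : F) ^ m) with he
    have hnewton : (k : ℂ) * ∑ a, χ a * φ a * e k a =
        (-1) ^ (k + 1) * ∑ i ∈ antidiagonal k with i.1 < k, (-1) ^ i.1 *
          ∑ a, χ a * φ a * (e i.1 a * ∑ x : Fˣ, ψ (a * (x : F) ^ m) ^ i.2) := by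
      simp_rw [Finset.mul_sum (s := filter _ _), Finset.mul_sum (s := (univ : Finset F))]
      rw [Finset.sum_comm]
      refine Finset.sum_congr rfl fun a _ ↦ ?_
      have := mul_sum_powersetCard_prod (fun x : Fˣ ↦ ψ (a * (x : F) ^ m)) k
      rw [mul_left_comm, this, ← mul_assoc, Finset.mul_sum]
      refine Finset.sum_congr rfl fun i _ ↦ ?_
      ring
    have hnorm := congrArg norm hnewton
    rw [norm_mul, norm_mul, Complex.norm_natCast, norm_pow, norm_neg, norm_one, one_pow,
      one_mul] at hnorm
    rw [hnorm]
    calc _ ≤ ∑ i ∈ antidiagonal k with i.1 < k,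
          (m * √q + if ringChar F ∣ i.2 then q else 0) *
            (risingCoeff (m * √q + q / ringChar F + 1) i.1 * √q) := by
          refine norm_sum_le_of_le _ fun i hi ↦ ?_
          rw [norm_mul, norm_pow, norm_neg, norm_one, one_pow, one_mul]
          exact norm_sum_mulChar_mul_powerSum_le hψ hm i.2 (ih i.1 (mem_filter.mp hi).2) χ
      _ = (∑ i ∈ range k, (m * √q + if ringChar F ∣ k - i then q else 0) *
            risingCoeff (m * √q + q / ringChar F + 1) i) * √q := by
          rw [Finset.sum_filter, Finset.Nat.sum_antidiagonal_eq_sum_range_succ_mk,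
            Finset.sum_range_succ, if_neg (lt_irrefl k), add_zero, Finset.sum_mul]
          refine Finset.sum_congr rfl fun i hi ↦ ?_
          rw [if_pos (Finset.mem_range.mp hi), mul_assoc]
      _ ≤ _ := by
          rw [← mul_assoc]
          gcongr

theorem Nstar_eq_card_embedding (m k : ℕ) (b : F) :
    Nstar m k b = #{e : Fin k ↪ Fˣ | ∑ i, (e i : F) ^ m = b} := by
  rw [← Fintype.card_subtype, ← Nat.card_eq_fintype_card]
  refine Nat.card_congr
    { toFun := fun x ↦ ⟨⟨fun i ↦ Units.mk0 (x.1 i) (x.2.2.1 i), fun i j h ↦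
        x.2.1 (by simpa using congrArg Units.val h)⟩, x.2.2.2⟩
      invFun := fun e ↦ ⟨fun i ↦ e.1 i, Units.val_injective.comp e.1.injective,
        fun i ↦ (e.1 i).ne_zero, e.2⟩
      left_inv := fun x ↦ rfl
      right_inv := fun e ↦ by ext; simp }

theorem card_mul_Nstar {ψ : AddChar F ℂ} (hψ : ψ.IsPrimitive) (m k : ℕ) (b : F) :
    (Fintype.card F : ℂ) * Nstar m k b =
      (Fintype.card Fˣ).descFactorial k + k.factorial * ∑ a, (1 : MulChar F ℂ) a *
        ψ.mulShift (-b) a *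
          ∑ s ∈ powersetCard k univ, ∏ x ∈ s, ψ (a * ((x : Fˣ) : F) ^ m) := by
  have hcount : (Fintype.card F : ℂ) * Nstar m k b =
      ∑ a, ψ.mulShift (-b) a * ∑ e : Fin k ↪ Fˣ, ∏ i, ψ (a * (e i : F) ^ m) := by
    rw [Nstar_eq_card_embedding, Finset.natCast_card_filter, Finset.mul_sum]
    simp_rw [Finset.mul_sum]
    rw [Finset.sum_comm]
    refine Finset.sum_congr rfl fun e _ ↦ ?_
    have := AddChar.sum_mulShift (∑ i, (e i : F) ^ m - b) hψ
    simp only [sub_eq_zero] at this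
    rw [mul_ite, mul_one, mul_zero]
    rw [Nat.cast_ite, Nat.cast_zero] at this
    rw [← this]
    refine Finset.sum_congr rfl fun a _ ↦ ?_
    rw [AddChar.mulShift_apply, mul_sub, sub_eq_neg_add, AddChar.map_add_eq_mul, Finset.mul_sum,
      addChar_sum_eq_prod, neg_mul, mul_comm b]
  rw [hcount, ← Finset.add_sum_erase _ _ (mem_univ (0 : F)),
    ← Finset.add_sum_erase univ (fun a ↦ (1 : MulChar F ℂ) a * _ * _) (mem_univ (0 : F))]
  simp only [MulChar.map_zero, zero_mul, zero_add]
  congr 1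
  · simp
  · rw [Finset.mul_sum]
    refine Finset.sum_congr rfl fun a ha ↦ ?_
    rw [MulChar.one_apply (Finset.ne_of_mem_erase ha).isUnit,
      sum_embedding_prod fun x : Fˣ ↦ ψ (a * (x : F) ^ m)]
    ring

end Estimate

end DiagonalDistinct

open DiagonalDistinct

theorem diagonal_distinct_estimate_ne_zero
    {F : Type*} [Field F] [Fintype F] (m : ℕ) (hm : 0 < m)
    (hmdvd : m ∣ Fintype.card F - 1) (k : ℕ) (hk : k ≤ Fintype.card F - 1)
    (b : F) (hb : b ≠ 0) :
    |(Nstar m k b : ℝ) -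
        fallingFactorial ((Fintype.card F : ℝ) - 1) k / (Fintype.card F : ℝ)|
      ≤ (2 / Real.sqrt (Fintype.card F)) *
          fallingFactorial
            ((m : ℝ) * Real.sqrt (Fintype.card F) + k +
              (Fintype.card F : ℝ) / ringChar F) k := by
  classical
  set q : ℝ := (Fintype.card F : ℝ) with hq
  have hq0 : 0 < q := by simpa [hq] using Fintype.card_pos (α := F)
  obtain ⟨ψ, hψ⟩ : ∃ ψ : AddChar F ℂ, ψ.IsPrimitive :=
    ⟨_, AddChar.FiniteField.primitiveChar_to_Complex_isPrimitive F⟩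
  have hφ : (ψ.mulShift (-b)).IsPrimitive := .of_ne_one (hψ (neg_ne_zero.mpr hb))
  have hbound := norm_sum_mulChar_mul_esymm_le hφ hψ hm k 1
  have hmain : fallingFactorial (q - 1) k = (Fintype.card Fˣ).descFactorial k := by
    rw [fallingFactorial, ← descPochhammer_eval_eq_descFactorial, Fintype.card_units,
      Nat.cast_pred Fintype.card_pos]
  set t : ℝ := m * √q + q / ringChar F + 1 with ht
  have hrise : fallingFactorial (m * √q + k + q / ringChar F) k =
      k.factorial * risingCoeff t k := by
    rw [fallingFactorial, descPochhammer_eval_eq_ascPochhammer, risingCoeff,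
      mul_div_cancel₀ _ (by positivity)]
    congr 1
    ring
  have hrise0 : 0 ≤ k.factorial * risingCoeff t k :=
    mul_nonneg (by positivity) (risingCoeff_nonneg (le_add_of_nonneg_left (by positivity)) k)
  rw [hmain, hrise]
  have hdiff : q * |(Nstar m k b : ℝ) - (Fintype.card Fˣ).descFactorial k / q| ≤
      k.factorial * (risingCoeff t k * √q) := by
    have h := card_mul_Nstar hψ m k b
    rw [← sub_eq_iff_eq_add'] at h
    have h := congrArg norm h
    rw [norm_mul, Complex.norm_natCast] at h
    refine le_trans (le_of_eq ?_) (h.le.trans (by gcongr))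
    rw [← abs_of_pos hq0, ← abs_mul, abs_of_pos hq0, mul_sub, mul_div_cancel₀ _ hq0.ne',
      ← Real.norm_eq_abs, ← Complex.norm_real]
    push_cast [hq]
    rfl
  have hsq : √q * √q = q := Real.mul_self_sqrt hq0.le
  have hs : 0 < √q := Real.sqrt_pos.mpr hq0
  calc _ ≤ k.factorial * (risingCoeff t k * √q) / q := by rwa [le_div_iff₀' hq0]
    _ = 1 / √q * (k.factorial * risingCoeff t k) := by
        nth_rewrite 2 [← hsq]
        field_simp
    _ ≤ _ := by
        gcongr
        norm_num
end

section
/- Let F_q be the finite field of q elements of characteristic p, let m be a positive divisor of q−1, and let 0 ≤ k ≤ q−1. Then |N_m^*(k,0) − (q−1)_k / q| ≤ (m√q + k + q/p)_k, where (t)_k = t(t−1)⋯(t−k+1) denotes the falling factorial of a real number t. -/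
open Finset in
theorem card_embedding_map_univ_eq {σ : Type*} [Fintype σ] [DecidableEq σ] {k : ℕ}
    {s : Finset σ} (hs : s.card = k) :
    #{e : Fin k ↪ σ | univ.map e = s} = k.factorial := by
  have key : ({e : Fin k ↪ σ | univ.map e = s} : Finset (Fin k ↪ σ)) =
      (univ : Finset (Fin k ↪ s)).image
        (fun g => g.trans (Function.Embedding.subtype (· ∈ s))) := by
    ext e
    simp only [mem_filter, mem_univ, true_and, mem_image]
    constructor
    · intro h
      have he : ∀ i, e i ∈ s := fun i => h ▸ mem_map_of_mem e (mem_univ i)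
      exact ⟨⟨fun i => ⟨e i, he i⟩, fun i j hij => e.injective (congrArg Subtype.val hij)⟩, rfl⟩
    · rintro ⟨g, rfl⟩
      refine eq_of_subset_of_card_le ?_ ?_
      · intro x hx
        obtain ⟨i, -, rfl⟩ := mem_map.1 hx
        exact (g i).2
      · simp [hs]
  rw [key, card_image_of_injective, card_univ, Fintype.card_embedding_eq]
  · simp [hs, Nat.descFactorial_self]
  · intro g h hgh
    ext i
    exact DFunLike.congr_fun hgh i

/-- The sum of `∏ f` over injective `k`-tuples is `k!` times an elementary symmetric function. -/
theorem sum_embedding_prod {σ R : Type*} [Fintype σ] [CommRing R] (k : ℕ) (f : σ → R) :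
    ∑ e : Fin k ↪ σ, ∏ i, f (e i) =
      k.factorial * MvPolynomial.aeval f (MvPolynomial.esymm σ R k) := by
  classical
  rw [MvPolynomial.esymm, map_sum, Finset.mul_sum, ← Finset.sum_fiberwise_of_maps_to
    (t := Finset.powersetCard k (Finset.univ : Finset σ)) (g := fun e => Finset.univ.map e)]
  · refine Finset.sum_congr rfl fun s hs => ?_
    rw [← card_embedding_map_univ_eq (Finset.mem_powersetCard.1 hs).2, ← nsmul_eq_mul]
    refine Finset.sum_eq_card_nsmul fun e he => ?_
    rw [← (Finset.mem_filter.1 he).2]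
    simp
  · intro e _
    simp [Finset.mem_powersetCard]

/-- Newton's identities bound elementary symmetric functions through power sums. -/
theorem mul_norm_esymm_le {σ : Type*} [Fintype σ] (f : σ → ℂ) (k : ℕ) :
    (k : ℝ) * ‖MvPolynomial.aeval f (MvPolynomial.esymm σ ℂ k)‖ ≤
      ∑ j ∈ Finset.range k,
        ‖MvPolynomial.aeval f (MvPolynomial.esymm σ ℂ j)‖ * ‖∑ x, f x ^ (k - j)‖ := by
  have h := congrArg (MvPolynomial.aeval f) (MvPolynomial.mul_esymm_eq_sum σ ℂ k)
  rw [Finset.sum_filter, Finset.Nat.sum_antidiagonal_eq_sum_range_succ_mk,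
    Finset.sum_range_succ, if_neg (lt_irrefl _), add_zero] at h
  have h' := congrArg norm h
  simp only [map_mul, map_pow, map_neg, map_one, map_natCast, norm_mul, norm_pow, norm_neg,
    norm_one, one_pow, one_mul, Complex.norm_natCast, map_sum] at h'
  rw [h']
  refine (norm_sum_le _ _).trans (Finset.sum_le_sum fun j hj => ?_)
  rw [if_pos (Finset.mem_range.1 hj)]
  simp [MvPolynomial.psum]

/-- The coefficients of `(1 - t)^(-R)`. -/
noncomputable def risingCoeff (R : ℝ) (k : ℕ) : ℝ :=
  (∏ j ∈ Finset.range k, (R + j)) / k.factorial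

theorem succ_mul_risingCoeff (R : ℝ) (k : ℕ) :
    ((k : ℝ) + 1) * risingCoeff R (k + 1) = (R + k) * risingCoeff R k := by
  have : (k.factorial : ℝ) ≠ 0 := by positivity
  have : (k : ℝ) + 1 ≠ 0 := by positivity
  rw [risingCoeff, risingCoeff, Finset.prod_range_succ, Nat.factorial_succ]
  push_cast
  field_simp

theorem risingCoeff_nonneg {R : ℝ} (hR : 0 ≤ R) (k : ℕ) : 0 ≤ risingCoeff R k :=
  div_nonneg (Finset.prod_nonneg fun _ _ => by positivity) (by positivity)

theorem mul_risingCoeff (R : ℝ) (k : ℕ) :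
    (k : ℝ) * risingCoeff R k = R * ∑ j ∈ Finset.range k, risingCoeff R j := by
  induction k with
  | zero => simp
  | succ k ih =>
    rw [Finset.sum_range_succ, mul_add, ← ih]
    push_cast
    rw [succ_mul_risingCoeff]
    ring

theorem risingCoeff_monotone {R : ℝ} (hR : 1 ≤ R) : Monotone (risingCoeff R) := by
  refine monotone_nat_of_le_succ fun k => ?_
  have h := succ_mul_risingCoeff R k
  have h0 := risingCoeff_nonneg (zero_le_one.trans hR) k
  have hk : (0 : ℝ) < k + 1 := by positivity
  refine le_of_mul_le_mul_left ?_ hk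
  rw [h]
  exact mul_le_mul_of_nonneg_right (by linarith) h0

/-- For a monotone sequence, the terms at a fixed residue contribute at most a proportional
share. -/
theorem mul_sum_dvd_le {r : ℕ → ℝ} (hr : Monotone r) (h0 : ∀ j, 0 ≤ r j) {p : ℕ} (hp : 0 < p)
    (k : ℕ) :
    (p : ℝ) * ∑ j ∈ Finset.range k, (if p ∣ k - j then r j else 0) ≤
      ∑ j ∈ Finset.range k, r j := by
  induction k using Nat.strong_induction_on with
  | _ k ih =>
    rcases lt_or_ge k p with hk | hk
    · rw [Finset.sum_eq_zero]
      · simpa using Finset.sum_nonneg fun j _ => h0 j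
      · intro j hj
        rw [Finset.mem_range] at hj
        exact if_neg (Nat.not_dvd_of_pos_of_lt (by omega) (by omega))
    · obtain ⟨n, rfl⟩ := Nat.exists_eq_add_of_le' hk
      rw [Finset.sum_range_add, Finset.sum_range_add, mul_add]
      refine add_le_add ?_ ?_
      · refine le_trans (le_of_eq ?_) (ih n (by omega))
        congr 1
        refine Finset.sum_congr rfl fun j hj => ?_
        rw [Finset.mem_range] at hj
        simp only [show n + p - j = (n - j) + p by omega, Nat.dvd_add_self_right]
      · have : ∑ i ∈ Finset.range p, (if p ∣ n + p - (n + i) then r (n + i) else 0) = r n := by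
          rw [Finset.sum_eq_single_of_mem 0 (by simpa using hp)]
          · simp
          · intro i hi hi0
            rw [Finset.mem_range] at hi
            exact if_neg (Nat.not_dvd_of_pos_of_lt (by omega) (by omega))
        rw [this]
        calc (p : ℝ) * r n = ∑ _i ∈ Finset.range p, r n := by simp
          _ ≤ _ := Finset.sum_le_sum fun i _ => hr (by omega)

/-- A bound for elementary symmetric functions from a bound `M` for the power sums whose index
is prime to `p` and a bound `M + q` for the others. -/
theorem norm_esymm_le {σ : Type*} [Fintype σ] (f : σ → ℂ) {p : ℕ} (hp : 0 < p) {M q : ℝ}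
    (hM : 0 ≤ M) (hq : (p : ℝ) ≤ q)
    (hf : ∀ l, ‖∑ x, f x ^ l‖ ≤ M + if p ∣ l then q else 0) (k : ℕ) :
    ‖MvPolynomial.aeval f (MvPolynomial.esymm σ ℂ k)‖ ≤ risingCoeff (M + q / p) k := by
  have hp' : (0 : ℝ) < p := by exact_mod_cast hp
  have hR : 1 ≤ M + q / p := by
    have : 1 ≤ q / p := (one_le_div hp').2 hq
    linarith
  set R := M + q / p with hRdef
  have h0 := risingCoeff_nonneg (zero_le_one.trans hR)
  induction k using Nat.strong_induction_on with
  | _ k ih =>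
    rcases Nat.eq_zero_or_pos k with rfl | hk
    · simp [risingCoeff]
    refine le_of_mul_le_mul_left ?_ (show (0 : ℝ) < k by exact_mod_cast hk)
    calc _ ≤ _ := mul_norm_esymm_le f k
      _ ≤ ∑ j ∈ Finset.range k, risingCoeff R j * (M + if p ∣ k - j then q else 0) :=
          Finset.sum_le_sum fun j hj => mul_le_mul (ih j (Finset.mem_range.1 hj)) (hf _)
            (norm_nonneg _) (h0 j)
      _ = M * ∑ j ∈ Finset.range k, risingCoeff R j +
          q / p * (p * ∑ j ∈ Finset.range k, (if p ∣ k - j then risingCoeff R j else 0)) := by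
          rw [← mul_assoc, div_mul_cancel₀ _ hp'.ne', Finset.mul_sum, Finset.mul_sum,
            ← Finset.sum_add_distrib]
          refine Finset.sum_congr rfl fun j _ => ?_
          split_ifs <;> ring
      _ ≤ M * ∑ j ∈ Finset.range k, risingCoeff R j +
          q / p * ∑ j ∈ Finset.range k, risingCoeff R j := by
          have hqp : 0 ≤ q / p := div_nonneg (hp'.le.trans hq) hp'.le
          have := mul_le_mul_of_nonneg_left
            (mul_sum_dvd_le (risingCoeff_monotone hR) h0 hp k) hqp
          linarith
      _ = k * risingCoeff R k := by rw [mul_risingCoeff, hRdef]; ring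

theorem factorial_mul_risingCoeff_le {R : ℝ} (hR : 0 ≤ R) (k : ℕ) :
    k.factorial * risingCoeff R k ≤ fallingFactorial (R + k) k := by
  have : (k.factorial : ℝ) ≠ 0 := by positivity
  rw [risingCoeff, mul_div_cancel₀ _ this, fallingFactorial, descPochhammer_eval_eq_prod_range,
    ← Finset.prod_range_reflect]
  refine Finset.prod_le_prod (fun _ _ => by positivity) fun j hj => ?_
  rw [Finset.mem_range] at hj
  have : ((k - 1 - j : ℕ) : ℝ) + j + 1 = k := by
    exact_mod_cast (show k - 1 - j + j + 1 = k by omega)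
  linarith

theorem card_units_pow_eq_le {F : Type*} [Field F] [Fintype F] [DecidableEq F] {m : ℕ}
    (hm : 0 < m) (b : F) :
    (Finset.univ.filter fun u : Fˣ => (u : F) ^ m = b).card ≤ m := by
  classical
  calc _ = ((Finset.univ.filter fun u : Fˣ => (u : F) ^ m = b).image Units.val).card :=
        (Finset.card_image_of_injective _ Units.val_injective).symm
    _ ≤ (Polynomial.nthRoots m b).toFinset.card := Finset.card_le_card fun x hx => by
        obtain ⟨u, hu, rfl⟩ := Finset.mem_image.1 hx
        simpa [Polynomial.mem_nthRoots hm] using hu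
    _ ≤ _ := (Multiset.toFinset_card_le _).trans (Polynomial.card_nthRoots m b)

theorem sum_norm_sq_sum_units_pow {F : Type*} [Field F] [Fintype F] [DecidableEq F]
    {ψ : AddChar F ℂ} (hψ : ψ.IsPrimitive) {m : ℕ} (hm : 0 < m) :
    ∑ d : F, ‖∑ x : Fˣ, ψ (d * (x : F) ^ m)‖ ^ 2 ≤
      (Fintype.card F : ℝ) * ((Fintype.card Fˣ : ℝ) * m) := by
  have key : ((∑ d : F, ‖∑ x : Fˣ, ψ (d * (x : F) ^ m)‖ ^ 2 : ℝ) : ℂ) =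
      ((Fintype.card F *
        ∑ y : Fˣ, (Finset.univ.filter fun x : Fˣ => (x : F) ^ m = (y : F) ^ m).card : ℕ) : ℂ) := by
    push_cast
    calc _ = ∑ d : F, ∑ y : Fˣ, ∑ x : Fˣ, ψ (d * ((x : F) ^ m - (y : F) ^ m)) := by
          refine Finset.sum_congr rfl fun d _ => ?_
          rw [← Complex.mul_conj', map_sum, Finset.sum_mul_sum, Finset.sum_comm]
          refine Finset.sum_congr rfl fun y _ => Finset.sum_congr rfl fun x _ => ?_
          rw [← AddChar.map_neg_eq_conj, ← AddChar.map_add_eq_mul]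
          congr 1
          ring
      _ = ∑ y : Fˣ, ∑ x : Fˣ, ∑ d : F, ψ (d * ((x : F) ^ m - (y : F) ^ m)) := by
          rw [Finset.sum_comm]
          exact Finset.sum_congr rfl fun y _ => Finset.sum_comm
      _ = _ := by
          rw [Finset.mul_sum]
          refine Finset.sum_congr rfl fun y _ => ?_
          simp_rw [AddChar.sum_mulShift _ hψ, sub_eq_zero]
          rw [← Nat.cast_sum, ← Finset.sum_filter, Finset.sum_const, smul_eq_mul]
          push_cast
          ring
  have key' := Complex.ofReal_injective (key.trans (Complex.ofReal_natCast _).symm)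
  rw [key']
  norm_cast
  gcongr
  rw [← smul_eq_mul, ← Finset.card_univ]
  exact Finset.sum_le_card_nsmul _ _ _ fun y _ => by
    exact_mod_cast card_units_pow_eq_le hm ((y : F) ^ m)

/-- Weil's bound for the exponential sums of `c x^m` over the nonzero elements. -/
theorem norm_sum_units_pow_le {F : Type*} [Field F] [Fintype F] [DecidableEq F] {ψ : AddChar F ℂ}
    (hψ : ψ.IsPrimitive) {m : ℕ} (hm : 0 < m) {c : F} (hc : c ≠ 0) :
    ‖∑ x : Fˣ, ψ (c * (x : F) ^ m)‖ ≤ m * Real.sqrt (Fintype.card F) := by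
  set T : F → ℝ := fun d => ‖∑ x : Fˣ, ψ (d * (x : F) ^ m)‖ with hT
  have hinv (u : Fˣ) : T (c * (u : F) ^ m) = T c := by
    simp only [hT]
    congr 1
    rw [← Equiv.sum_comp (Equiv.mulLeft u) fun x => ψ (c * (x : F) ^ m)]
    refine Finset.sum_congr rfl fun x _ => ?_
    simp [mul_pow, mul_assoc]
  have hcard : (0 : ℝ) < Fintype.card Fˣ := by exact_mod_cast Fintype.card_pos
  have h1 : (Fintype.card Fˣ : ℝ) * T c ^ 2 ≤
      Fintype.card Fˣ * (m * Real.sqrt (Fintype.card F)) ^ 2 :=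
    calc (Fintype.card Fˣ : ℝ) * T c ^ 2 = ∑ u : Fˣ, T (c * (u : F) ^ m) ^ 2 := by simp [hinv]
      _ = ∑ d : F, ∑ u ∈ Finset.univ.filter fun u : Fˣ => c * (u : F) ^ m = d,
          T (c * (u : F) ^ m) ^ 2 :=
          (Finset.sum_fiberwise _ _ _).symm
      _ ≤ ∑ d : F, m * T d ^ 2 := by
          refine Finset.sum_le_sum fun d _ => ?_
          rw [Finset.sum_congr rfl (g := fun _ => T d ^ 2) fun u hu => by
            rw [(Finset.mem_filter.1 hu).2], Finset.sum_const, nsmul_eq_mul]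
          refine mul_le_mul_of_nonneg_right ?_ (sq_nonneg _)
          have := card_units_pow_eq_le hm (c⁻¹ * d)
          simp_rw [eq_inv_mul_iff_mul_eq₀ hc] at this
          exact_mod_cast this
      _ = m * ∑ d : F, T d ^ 2 := (Finset.mul_sum _ _ _).symm
      _ ≤ m * ((Fintype.card F : ℝ) * ((Fintype.card Fˣ : ℝ) * m)) :=
          mul_le_mul_of_nonneg_left (sum_norm_sq_sum_units_pow hψ hm) (by positivity)
      _ = _ := by
          rw [mul_pow, Real.sq_sqrt (by positivity)]
          ring
  exact le_of_sq_le_sq (le_of_mul_le_mul_left h1 hcard) (by positivity)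

theorem Nstar_eq_card_embedding {F : Type*} [Field F] [Fintype F] [DecidableEq F] (m k : ℕ)
    (b : F) :
    Nstar m k b =
      (Finset.univ.filter fun e : Fin k ↪ Fˣ => ∑ i, (e i : F) ^ m = b).card := by
  rw [Nstar, ← Fintype.card_subtype, ← Nat.card_eq_fintype_card]
  refine Nat.card_congr
    { toFun := fun x => ⟨⟨fun i => Units.mk0 (x.1 i) (x.2.2.1 i), fun i j hij =>
          x.2.1 (by simpa using congrArg Units.val hij)⟩, x.2.2.2⟩
      invFun := fun e => ⟨fun i => e.1 i, fun i j hij => e.1.injective (Units.ext hij),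
        fun i => (e.1 i).ne_zero, e.2⟩
      left_inv := fun x => rfl
      right_inv := fun e => by ext; rfl }

theorem AddChar.prod_apply_eq_apply_sum {ι A R : Type*} [AddCommMonoid A] [CommMonoid R]
    (ψ : AddChar A R) (s : Finset ι) (f : ι → A) :
    ∏ i ∈ s, ψ (f i) = ψ (∑ i ∈ s, f i) := by
  classical
  induction s using Finset.induction_on with
  | empty => simp
  | insert i s hi ih => rw [Finset.prod_insert hi, Finset.sum_insert hi, ψ.map_add_eq_mul, ih]

theorem card_mul_Nstar_zero {F : Type*} [Field F] [Fintype F] [DecidableEq F] {ψ : AddChar F ℂ}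
    (hψ : ψ.IsPrimitive) (m k : ℕ) :
    (Fintype.card F : ℂ) * Nstar m k (0 : F) =
      ∑ a : F, ∑ e : Fin k ↪ Fˣ, ∏ i, ψ (a * (e i : F) ^ m) := by
  have h (a : F) (e : Fin k ↪ Fˣ) :
      ∏ i, ψ (a * (e i : F) ^ m) = ψ (a * ∑ i, (e i : F) ^ m) := by
    rw [Finset.mul_sum, AddChar.prod_apply_eq_apply_sum]
  simp_rw [h]
  rw [Finset.sum_comm]
  simp_rw [AddChar.sum_mulShift _ hψ]
  rw [← Nat.cast_sum, ← Finset.sum_filter, Finset.sum_const, Nstar_eq_card_embedding, smul_eq_mul]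
  push_cast
  ring

/-- The sum of a twisted additive character over injective tuples is small. -/
theorem norm_sum_embedding_prod_le {F : Type*} [Field F] [Fintype F] [DecidableEq F] {ψ : AddChar F ℂ}
    (hψ : ψ.IsPrimitive) {m : ℕ} (hm : 0 < m) (k : ℕ) {a : F} (ha : a ≠ 0) :
    ‖∑ e : Fin k ↪ Fˣ, ∏ i, ψ (a * (e i : F) ^ m)‖ ≤
      fallingFactorial ((m : ℝ) * Real.sqrt (Fintype.card F) + k +
            (Fintype.card F : ℝ) / ringChar F) k := by
  obtain ⟨n, hp, hn⟩ := FiniteField.card F (ringChar F)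
  have hpq : ringChar F ≤ Fintype.card F := hn ▸ Nat.le_self_pow n.ne_zero _
  have hsum (l : ℕ) : ‖∑ x : Fˣ, ψ (a * (x : F) ^ m) ^ l‖ ≤
      (m : ℝ) * Real.sqrt (Fintype.card F) +
        if ringChar F ∣ l then (Fintype.card F : ℝ) else 0 := by
    split_ifs with hl
    · have : ‖∑ x : Fˣ, ψ (a * (x : F) ^ m) ^ l‖ ≤ Fintype.card F := by
        refine (norm_sum_le _ _).trans ?_
        simp only [norm_pow, AddChar.norm_apply, one_pow, Finset.sum_const, nsmul_eq_mul, mul_one]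
        exact_mod_cast Fintype.card_le_of_injective _ Units.val_injective
      have : 0 ≤ (m : ℝ) * Real.sqrt (Fintype.card F) := by positivity
      linarith
    · have hla : (l : F) * a ≠ 0 := mul_ne_zero (fun h => hl ((ringChar.spec F l).1 h)) ha
      rw [add_zero]
      refine le_trans (le_of_eq ?_) (norm_sum_units_pow_le hψ hm hla)
      simp_rw [← AddChar.map_nsmul_eq_pow, nsmul_eq_mul, mul_assoc]
  rw [sum_embedding_prod k (fun x : Fˣ => ψ (a * (x : F) ^ m)), norm_mul, Complex.norm_natCast]
  refine (mul_le_mul_of_nonneg_left (norm_esymm_le _ hp.pos (by positivity)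
    (by exact_mod_cast hpq) hsum k) (by positivity)).trans ?_
  rw [add_right_comm]
  exact factorial_mul_risingCoeff_le (by positivity) k

theorem diagonal_distinct_estimate_zero
    {F : Type*} [Field F] [Fintype F] (m : ℕ) (hm : 0 < m)
    (hmdvd : m ∣ Fintype.card F - 1) (k : ℕ) (hk : k ≤ Fintype.card F - 1) :
    |(Nstar m k (0 : F) : ℝ) -
        fallingFactorial ((Fintype.card F : ℝ) - 1) k / (Fintype.card F : ℝ)|
      ≤ fallingFactorial
          ((m : ℝ) * Real.sqrt (Fintype.card F) + k +
            (Fintype.card F : ℝ) / ringChar F) k := by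
  classical
  have hψ := AddChar.FiniteField.primitiveChar_to_Complex_isPrimitive F
  set ψ := AddChar.FiniteField.primitiveChar_to_Complex F
  set B := fallingFactorial ((m : ℝ) * Real.sqrt (Fintype.card F) + k +
            (Fintype.card F : ℝ) / ringChar F) k
  have hB : 0 ≤ B :=
    (norm_nonneg _).trans (norm_sum_embedding_prod_le hψ hm k (one_ne_zero : (1 : F) ≠ 0))
  have hq : (0 : ℝ) < Fintype.card F := by exact_mod_cast Fintype.card_pos
  have hfall : fallingFactorial ((Fintype.card F : ℝ) - 1) k =
      (Fintype.card (Fin k ↪ Fˣ) : ℝ) := by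
    rw [Fintype.card_embedding_eq, Fintype.card_units, Fintype.card_fin, fallingFactorial,
      ← descPochhammer_eval_eq_descFactorial, Nat.cast_sub Fintype.card_pos, Nat.cast_one]
  have hcount := card_mul_Nstar_zero hψ m k
  rw [← Finset.add_sum_erase _ _ (Finset.mem_univ (0 : F))] at hcount
  have hdiff : (((Fintype.card F : ℝ) * Nstar m k (0 : F) -
      fallingFactorial ((Fintype.card F : ℝ) - 1) k : ℝ) : ℂ) =
      ∑ a ∈ Finset.univ.erase (0 : F), ∑ e : Fin k ↪ Fˣ, ∏ i, ψ (a * (e i : F) ^ m) := by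
    rw [hfall]
    push_cast
    rw [hcount]
    simp
  have hbound : |(Fintype.card F : ℝ) * Nstar m k (0 : F) -
      fallingFactorial ((Fintype.card F : ℝ) - 1) k| ≤ Fintype.card F * B := by
    rw [← Real.norm_eq_abs, ← Complex.norm_real, hdiff]
    calc _ ≤ ∑ a ∈ Finset.univ.erase (0 : F), B :=
          norm_sum_le_of_le _ fun a ha =>
            norm_sum_embedding_prod_le hψ hm k (Finset.ne_of_mem_erase ha)
      _ ≤ ∑ _a : F, B :=
          Finset.sum_le_sum_of_subset_of_nonneg (Finset.erase_subset _ _) fun _ _ _ => hB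
      _ = _ := by simp
  refine le_of_mul_le_mul_left ?_ hq
  calc _ = _ := by
        rw [← abs_of_pos hq, ← abs_mul, abs_of_pos hq, mul_sub, mul_div_cancel₀ _ hq.ne']
    _ ≤ _ := hbound
end

section
/- Let F_q be a finite field, d_1,…,d_n positive integers with each d_i | (q−1), and a_1,…,a_n ∈ F_q^*. Let N_0* be the number of solutions (x_1,…,x_n) ∈ (F_q^*)^n of a_1·x_1^{d_1} + ⋯ + a_n·x_n^{d_n} = 0. Then |N_0* − (1/q)·(q−1)^n| ≤ (q−1)/q + Σ_{e=0}^{n−1} Σ (q−1)·q^{(n−e)/2 − 1}, where the inner sum is over all choices of indices 1 ≤ i_{e+1} < ⋯ < i_n ≤ n and integers 1 ≤ l_{i_j} ≤ d_{i_j} − 1 with l_{i_{e+1}}/d_{i_{e+1}} + ⋯ + l_{i_n}/d_{i_n} ∈ Z. In particular, if d_i = m for all i, then |N_0* − (1/q)·(q−1)^n| ≤ ((q−1)/q)·(1 + (m−1)√q)^n ≤ (1 + (m−1)√q)^n. -/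
open scoped Classical

theorem MulChar.norm_apply_le_one {F : Type*} [Field F] [Fintype F] (χ : MulChar F ℂ) (a : F) :
    ‖χ a‖ ≤ 1 := by
  rcases eq_or_ne a 0 with rfl | ha
  · simp
  · have h := MulChar.apply_mem_rootsOfUnity (Units.mk0 a ha) (χ := χ)
    rw [mem_rootsOfUnity, Units.ext_iff] at h
    have h2 : (χ a) ^ Fintype.card Fˣ = 1 := by simpa using h
    exact (Complex.norm_eq_one_of_pow_eq_one h2 Fintype.card_ne_zero).le

theorem norm_gaussSum_eq_sqrt_card {F : Type*} [Field F] [Fintype F] {χ : MulChar F ℂ} (hχ : χ ≠ 1)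
    {ψ : AddChar F ℂ} (hψ : ψ.IsPrimitive) :
    ‖gaussSum χ ψ‖ = √(Fintype.card F) := by
  have h := gaussSum_mul_gaussSum_eq_card hχ hψ
  rw [← star_gaussSum_eq] at h
  have h2 := congrArg norm h
  rw [norm_mul, norm_star, Complex.norm_natCast] at h2
  rw [← h2, Real.sqrt_mul_self (norm_nonneg _)]

theorem card_filter_pow_eq_sum_mulChar {F : Type*} [Field F] [Fintype F] {χ : MulChar F ℂ}
    {d : ℕ} (hd : 0 < d) (hχ : orderOf χ = d) {y : F} (hy : y ≠ 0) :
    ((Finset.univ.filter fun x : F => x ^ d = y).card : ℂ) = ∑ l ∈ Finset.range d, (χ ^ l) y := by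
  obtain ⟨g, hg⟩ := IsCyclic.exists_generator (α := Fˣ)
  have hχg : ∀ m : ℕ, χ g ^ m = 1 ↔ d ∣ m := fun m => by
    rw [← hχ, orderOf_dvd_iff_pow_eq_one, MulChar.eq_iff hg]
    simp [MulChar.pow_apply_coe]
  have hdvd : d ∣ Fintype.card Fˣ := hχ ▸ orderOf_dvd_of_pow_eq_one χ.pow_card_eq_one
  obtain ⟨c, hc⟩ := hdvd
  have hprim : IsPrimitiveRoot ((g : F) ^ c) d := by
    refine IsPrimitiveRoot.pow (n := Fintype.card Fˣ) Fintype.card_pos ?_ (by rw [hc, mul_comm])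
    rw [← Nat.card_eq_fintype_card, ← orderOf_eq_card_of_forall_mem_zpowers hg,
      IsPrimitiveRoot.coe_units_iff]
    exact IsPrimitiveRoot.orderOf g
  have hcard : (Finset.univ.filter fun x : F => x ^ d = y).card =
      if ∃ x, x ^ d = y then d else 0 := by
    have h := hprim.card_nthRoots y
    rw [← Multiset.toFinset_card_of_nodup (hprim.nthRoots_nodup hy)] at h
    convert h using 2
    ext x
    simp [Polynomial.mem_nthRoots hd]
  have hval : ∀ l, (χ ^ l) y = χ y ^ l := fun l => MulChar.pow_apply_coe χ l (Units.mk0 y hy)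
  have hiff : (∃ x, x ^ d = y) ↔ χ y = 1 := by
    constructor
    · rintro ⟨x, rfl⟩
      have hx : x ≠ 0 := by rintro rfl; simp [hd.ne'] at hy
      rw [map_pow, ← MulChar.pow_apply' _ hd.ne', ← hχ, pow_orderOf_eq_one,
        MulChar.one_apply hx.isUnit]
    · intro h
      obtain ⟨k, hk⟩ := (mem_powers_iff_mem_zpowers).2 (hg (Units.mk0 y hy))
      have hk' : y = (g : F) ^ k := by simpa using (congrArg Units.val hk).symm
      rw [hk', map_pow, hχg] at h
      obtain ⟨e, rfl⟩ := h
      exact ⟨(g : F) ^ e, by rw [hk', ← pow_mul, mul_comm]⟩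
  simp_rw [hcard, hiff, hval]
  split_ifs with h
  · simp [h]
  · have hyd : χ y ^ d = 1 := by
      rw [← hval, ← hχ, pow_orderOf_eq_one, MulChar.one_apply hy.isUnit]
    rw [geom_sum_eq h, hyd]
    simp

theorem sum_filter_ne_zero_pow {F : Type*} [Field F] [Fintype F] {χ : MulChar F ℂ}
    {d : ℕ} (hd : 0 < d) (hχ : orderOf χ = d) (f : F → ℂ) :
    ∑ x with x ≠ 0, f (x ^ d) = ∑ l ∈ Finset.range d, ∑ y, (χ ^ l) y * f y := by
  rw [Finset.sum_comm, ← Finset.sum_fiberwise (Finset.univ.filter fun x : F => x ≠ 0)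
    (fun x => x ^ d)]
  refine Finset.sum_congr rfl fun y _ => ?_
  rw [← Finset.sum_mul]
  rcases eq_or_ne y 0 with rfl | hy
  · rw [Finset.sum_eq_zero, Finset.sum_eq_zero, zero_mul]
    · exact fun l _ => (χ ^ l).map_zero
    · intro x hx
      simp [hd.ne'] at hx
  · rw [← card_filter_pow_eq_sum_mulChar hd hχ hy, Finset.filter_filter, ← nsmul_eq_mul,
      ← Finset.sum_const]
    refine Finset.sum_congr ?_ (by simp +contextual)
    ext x
    simp only [Finset.mem_filter, Finset.mem_univ, true_and, and_iff_right_iff_imp]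
    rintro rfl rfl
    simp [hd.ne'] at hy

/-- Tuples `l` with `∑ l i / d i` integral, weighted by `s` to the number of their nonzero entries,
grouped by support. -/
theorem sum_piFinset_filter_prod {n : ℕ} {d : Fin n → ℕ} (hd : ∀ i, 0 < d i) (s : ℝ) :
    ∑ l ∈ (Fintype.piFinset fun i => Finset.range (d i)).filter
        (fun l => ∃ z : ℤ, ∑ i, ((l i : ℚ) / (d i : ℚ)) = z),
      ∏ i, (if l i = 0 then 1 else s) =
    ∑ S ∈ (Finset.univ : Finset (Fin n)).powerset,
      ((S.pi fun j => Finset.Icc 1 (d j - 1)).filter fun l => ∃ z : ℤ,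
        ∑ j ∈ S.attach, ((l j.1 j.2 : ℚ) / (d j.1 : ℚ)) = (z : ℚ)).card * s ^ S.card := by
  rw [← Finset.sum_fiberwise_of_maps_to (g := fun l => Finset.univ.filter fun i => l i ≠ 0)
    (t := Finset.univ.powerset) (by simp)]
  refine Finset.sum_congr rfl fun S _ => ?_
  rw [← nsmul_eq_mul, ← Finset.sum_const]
  refine Finset.sum_bij' (fun l _ j _ => l j) (fun l _ i => if h : i ∈ S then l i h else 0)
    ?_ ?_ ?_ ?_ ?_
  · intro l hl
    simp only [Finset.mem_filter, Fintype.mem_piFinset, Finset.mem_range, Finset.mem_pi,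
      Finset.mem_Icc] at hl ⊢
    obtain ⟨⟨h1, z, hz⟩, rfl⟩ := hl
    refine ⟨fun i hi => ?_, z, ?_⟩
    · have := h1 i
      simp at hi
      omega
    · rw [← hz, Finset.sum_attach _ (fun i => (l i : ℚ) / d i)]
      refine Finset.sum_subset (Finset.subset_univ _) fun i _ hi => ?_
      simp at hi
      simp [hi]
  · intro l hl
    simp only [Finset.mem_filter, Fintype.mem_piFinset, Finset.mem_range, Finset.mem_pi,
      Finset.mem_Icc] at hl ⊢
    obtain ⟨h1, z, hz⟩ := hl
    refine ⟨⟨fun i => ?_, z, ?_⟩, ?_⟩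
    · split_ifs with h
      · have := h1 i h
        have := hd i
        omega
      · exact hd i
    · rw [← hz, ← Finset.sum_subset (Finset.subset_univ S), ← Finset.sum_attach]
      · exact Finset.sum_congr rfl fun i _ => by simp
      · intro i _ hi
        simp [hi]
    · ext i
      simp only [Finset.mem_filter, Finset.mem_univ, true_and]
      split_ifs with h
      · have := (h1 i h).1
        simp [h]; omega
      · simp [h]
  · intro l hl
    obtain rfl := (Finset.mem_filter.1 hl).2
    ext i
    by_cases h : l i = 0 <;> simp [h]
  · intro l hl
    ext i hi
    simp [hi]
  · intro l hl
    obtain rfl := (Finset.mem_filter.1 hl).2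
    simp [Finset.prod_ite]

theorem sum_filter_ne_zero_addChar_mul_pow {F : Type*} [Field F] [Fintype F] {χ : MulChar F ℂ}
    {d : ℕ} (hd : 0 < d) (hχ : orderOf χ = d) (ψ : AddChar F ℂ) {a : F} (ha : a ≠ 0) :
    ∑ x with x ≠ 0, ψ (a * x ^ d) =
      ∑ l ∈ Finset.range d, (χ ^ l)⁻¹ a * gaussSum (χ ^ l) ψ := by
  rw [sum_filter_ne_zero_pow hd hχ fun y => ψ (a * y)]
  refine Finset.sum_congr rfl fun l _ => ?_
  exact gaussSum_mulShift_eq (χ ^ l) ψ (Units.mk0 a ha)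

theorem card_mul_card_filter_diagonal {F : Type*} [Field F] [Fintype F] {n : ℕ} (d : Fin n → ℕ)
    (a : Fin n → F) {ψ : AddChar F ℂ} (hψ : ψ.IsPrimitive) :
    (Fintype.card F : ℂ) * (Finset.univ.filter fun x : Fin n → F =>
        (∀ i, x i ≠ 0) ∧ ∑ i, a i * x i ^ d i = 0).card =
      ((Fintype.card F : ℂ) - 1) ^ n +
        ∑ b with b ≠ 0, ∏ i, ∑ x with x ≠ 0, ψ (b * a i * x ^ d i) := by
  have hsum : ∀ (s : Finset (Fin n)) (f : Fin n → F), ψ (∑ i ∈ s, f i) = ∏ i ∈ s, ψ (f i) :=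
    fun s f => map_prod ψ.toMonoidHom (fun i => Multiplicative.ofAdd (f i)) s
  have hfactor : ∀ b : F, ∏ i, ∑ x with x ≠ 0, ψ (b * a i * x ^ d i) =
      ∑ x ∈ Fintype.piFinset fun _ : Fin n => Finset.univ.filter fun x : F => x ≠ 0,
        ψ (b * ∑ i, a i * x i ^ d i) := fun b => by
    rw [Finset.prod_univ_sum]
    refine Finset.sum_congr rfl fun x _ => ?_
    rw [Finset.mul_sum, hsum]
    simp only [mul_assoc]
  have hzero : ∏ i, ∑ x with x ≠ 0, ψ (0 * a i * x ^ d i) = ((Fintype.card F : ℂ) - 1) ^ n := by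
    have hcard : (Finset.univ.filter fun x : F => x ≠ 0).card = Fintype.card F - 1 := by
      rw [Finset.filter_ne', Finset.card_erase_of_mem (Finset.mem_univ _), Finset.card_univ]
    simp [hcard, Nat.cast_sub Fintype.card_pos]
  have hsplit := Finset.add_sum_erase Finset.univ
    (fun b => ∏ i, ∑ x with x ≠ 0, ψ (b * a i * x ^ d i)) (Finset.mem_univ 0)
  rw [hzero, ← Finset.filter_ne'] at hsplit
  rw [hsplit]
  simp_rw [hfactor]
  rw [Finset.sum_comm]
  simp_rw [AddChar.sum_mulShift _ hψ]
  rw [← Nat.cast_sum, ← Finset.sum_filter, Finset.sum_const, smul_eq_mul, mul_comm, ← Nat.cast_mul]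
  congr 3
  ext x
  simp [Fintype.mem_piFinset]

theorem prod_pow_eq_one_iff {M : Type*} [CommGroup M] {χ : M} {N n : ℕ} (hN : 0 < N)
    (hχ : orderOf χ = N) {d : Fin n → ℕ} (hd : ∀ i, 0 < d i) (hdvd : ∀ i, d i ∣ N) (l : Fin n → ℕ) :
    ∏ i, (χ ^ (N / d i)) ^ l i = 1 ↔ ∃ z : ℤ, ∑ i, ((l i : ℚ) / (d i : ℚ)) = z := by
  have hsum : ((∑ i, N / d i * l i : ℕ) : ℚ) = N * ∑ i, ((l i : ℚ) / (d i : ℚ)) := by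
    rw [Finset.mul_sum]
    push_cast
    refine Finset.sum_congr rfl fun i _ => ?_
    rw [Nat.cast_div (hdvd i) (by exact_mod_cast (hd i).ne')]
    ring
  have hN' : (N : ℚ) ≠ 0 := by exact_mod_cast hN.ne'
  simp_rw [← pow_mul]
  rw [Finset.prod_pow_eq_pow_sum, ← orderOf_dvd_iff_pow_eq_one, hχ, ← Int.natCast_dvd_natCast]
  constructor
  · rintro ⟨z, hz⟩
    refine ⟨z, mul_left_cancel₀ hN' ?_⟩
    have hz' := congrArg (Int.cast : ℤ → ℚ) hz
    push_cast at hz'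
    rw [← hsum]
    push_cast
    exact hz'
  · rintro ⟨z, hz⟩
    refine ⟨z, ?_⟩
    rw [hz] at hsum
    apply Int.cast_injective (α := ℚ)
    push_cast
    push_cast at hsum
    exact hsum

theorem sum_prod_sum_inv_mul {F : Type*} [Field F] [Fintype F] {n : ℕ} (d : Fin n → ℕ)
    (a : Fin n → F) (η : Fin n → MulChar F ℂ) (G : Fin n → ℕ → ℂ) :
    ∑ b with b ≠ 0, ∏ i, ∑ l ∈ Finset.range (d i), (η i ^ l)⁻¹ (b * a i) * G i l =
      ((Fintype.card F : ℂ) - 1) *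
      ∑ l ∈ (Fintype.piFinset fun i => Finset.range (d i)).filter fun l => ∏ i, η i ^ l i = 1,
        ∏ i, (η i ^ l i)⁻¹ (a i) * G i (l i) := by
  have hprod : ∀ (s : Finset (Fin n)) (θ : Fin n → MulChar F ℂ) (b : F), b ≠ 0 →
      ∏ i ∈ s, (θ i) b = (∏ i ∈ s, θ i) b := fun s θ b hb => by
    induction s using Finset.induction_on with
    | empty => simp [MulChar.one_apply hb.isUnit]
    | insert i s hi ih => rw [Finset.prod_insert hi, Finset.prod_insert hi, ih, MulChar.mul_apply]
  have hsum : ∀ θ : MulChar F ℂ, ∑ b with b ≠ 0, θ b =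
      if θ = 1 then (Fintype.card F : ℂ) - 1 else 0 := fun θ => by
    have h0 : ∑ b with b ≠ 0, θ b = ∑ b, θ b :=
      Finset.sum_subset (Finset.filter_subset _ _) fun b _ hb => by
        obtain rfl : b = 0 := by simpa using hb
        exact θ.map_zero
    rw [h0]
    split_ifs with h
    · rw [h, MulChar.sum_one_eq_card_units, Fintype.card_units, Nat.cast_sub Fintype.card_pos,
        Nat.cast_one]
    · exact MulChar.sum_eq_zero_of_ne_one h
  simp_rw [Finset.prod_univ_sum]
  rw [Finset.sum_comm, Finset.sum_filter, Finset.mul_sum]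
  refine Finset.sum_congr rfl fun l _ => ?_
  have hterm : ∀ b ∈ Finset.univ.filter (fun b : F => b ≠ 0),
      ∏ i, (η i ^ l i)⁻¹ (b * a i) * G i (l i) =
        (∏ i, η i ^ l i)⁻¹ b * ∏ i, (η i ^ l i)⁻¹ (a i) * G i (l i) := fun b hb => by
    rw [← Finset.prod_inv_distrib, ← hprod _ _ _ (Finset.mem_filter.1 hb).2,
      ← Finset.prod_mul_distrib]
    simp only [map_mul, mul_assoc]
  rw [Finset.sum_congr rfl hterm, ← Finset.sum_mul, hsum]
  simp only [inv_eq_one]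
  split_ifs <;> simp

theorem abs_card_filter_diagonal_sub_le {F : Type*} [Field F] [Fintype F] {n : ℕ}
    (d : Fin n → ℕ) (hd : ∀ i, 0 < d i) (hddvd : ∀ i, d i ∣ Fintype.card F - 1)
    (a : Fin n → F) (ha : ∀ i, a i ≠ 0) :
    |((Finset.univ.filter fun x : Fin n → F =>
          (∀ i, x i ≠ 0) ∧ ∑ i, a i * x i ^ d i = 0).card : ℝ) -
        (1 / (Fintype.card F : ℝ)) * ((Fintype.card F : ℝ) - 1) ^ n| ≤
      ((Fintype.card F : ℝ) - 1) / Fintype.card F *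
        ∑ l ∈ (Fintype.piFinset fun i => Finset.range (d i)).filter
            (fun l => ∃ z : ℤ, ∑ i, ((l i : ℚ) / (d i : ℚ)) = z),
          ∏ i, (if l i = 0 then 1 else √(Fintype.card F)) := by
  obtain ⟨χ, hχ⟩ := MulChar.exists_mulChar_orderOf_eq_card_units F
    (Complex.isPrimitiveRoot_exp (Fintype.card Fˣ) Fintype.card_ne_zero)
  rw [Fintype.card_units] at hχ
  have hq1 : 0 < Fintype.card F - 1 := Nat.sub_pos_of_lt Fintype.one_lt_card
  have hq : (0 : ℝ) < Fintype.card F := by exact_mod_cast Fintype.card_pos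
  have hqsub : (0 : ℝ) ≤ (Fintype.card F : ℝ) - 1 :=
    sub_nonneg.2 (by exact_mod_cast Fintype.card_pos)
  obtain ⟨ψ, hψ⟩ : ∃ ψ : AddChar F ℂ, ψ.IsPrimitive :=
    ⟨_, AddChar.FiniteField.primitiveChar_to_Complex_isPrimitive F⟩
  have hη : ∀ i, orderOf (χ ^ ((Fintype.card F - 1) / d i)) = d i := fun i => by
    rw [orderOf_pow_of_dvd (Nat.div_pos (Nat.le_of_dvd hq1 (hddvd i)) (hd i)).ne'
      (hχ.symm ▸ Nat.div_dvd_of_dvd (hddvd i)), hχ, Nat.div_div_self (hddvd i) hq1.ne']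
  have hgauss : ∀ i, ∀ l < d i, ‖gaussSum ((χ ^ ((Fintype.card F - 1) / d i)) ^ l) ψ‖ =
      if l = 0 then 1 else √(Fintype.card F) := fun i l hl => by
    split_ifs with h
    · have hψ1 : ψ ≠ 1 := by simpa using hψ one_ne_zero
      rw [h, pow_zero, gaussSum_one_left hψ1]
      simp
    · refine norm_gaussSum_eq_sqrt_card (fun h1 => ?_) hψ
      have h2 := orderOf_dvd_of_pow_eq_one h1
      rw [hη] at h2
      exact h (Nat.eq_zero_of_dvd_of_lt h2 hl)
  have hN := card_mul_card_filter_diagonal d a hψ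
  have hexpand : ∀ b ∈ Finset.univ.filter (fun b : F => b ≠ 0),
      ∏ i, ∑ x with x ≠ 0, ψ (b * a i * x ^ d i) =
        ∏ i, ∑ l ∈ Finset.range (d i),
          ((χ ^ ((Fintype.card F - 1) / d i)) ^ l)⁻¹ (b * a i) *
            gaussSum ((χ ^ ((Fintype.card F - 1) / d i)) ^ l) ψ := fun b hb =>
    Finset.prod_congr rfl fun i _ => sum_filter_ne_zero_addChar_mul_pow (hd i) (hη i) ψ
      (mul_ne_zero (Finset.mem_filter.1 hb).2 (ha i))
  rw [Finset.sum_congr rfl hexpand,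
    sum_prod_sum_inv_mul d a (fun i => χ ^ ((Fintype.card F - 1) / d i))
      (fun i l => gaussSum ((χ ^ ((Fintype.card F - 1) / d i)) ^ l) ψ)] at hN
  simp_rw [prod_pow_eq_one_iff hq1 hχ hd hddvd] at hN
  have hbound : ∀ N : ℝ, ‖((Fintype.card F : ℝ) * N - ((Fintype.card F : ℝ) - 1) ^ n : ℂ)‖ =
      Fintype.card F * |N - 1 / (Fintype.card F : ℝ) * ((Fintype.card F : ℝ) - 1) ^ n| := fun N => by
    have hqC : (Fintype.card F : ℂ) ≠ 0 := by exact_mod_cast hq.ne'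
    have hcast : ((Fintype.card F : ℝ) * N - ((Fintype.card F : ℝ) - 1) ^ n : ℂ) =
        ((Fintype.card F * (N - 1 / (Fintype.card F : ℝ) * ((Fintype.card F : ℝ) - 1) ^ n) : ℝ) :
          ℂ) := by
      push_cast
      field_simp
    rw [hcast, Complex.norm_real, Real.norm_eq_abs, abs_mul, abs_of_pos hq]
  refine le_of_mul_le_mul_left ?_ hq
  rw [← hbound, ← mul_assoc, mul_div_cancel₀ _ hq.ne']
  simp only [Complex.ofReal_natCast]
  rw [hN, add_sub_cancel_left, norm_mul]
  have hqn : ‖(Fintype.card F : ℂ) - 1‖ = (Fintype.card F : ℝ) - 1 := by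
    rw [← Complex.ofReal_natCast, ← Complex.ofReal_one, ← Complex.ofReal_sub, Complex.norm_real,
      Real.norm_of_nonneg hqsub]
  rw [hqn]
  refine mul_le_mul_of_nonneg_left ((norm_sum_le _ _).trans (Finset.sum_le_sum fun l hl => ?_)) hqsub
  rw [norm_prod]
  refine Finset.prod_le_prod (fun _ _ => norm_nonneg _) fun i _ => ?_
  rw [norm_mul, hgauss i (l i)
    (Finset.mem_range.1 (Fintype.mem_piFinset.1 (Finset.mem_filter.1 hl).1 i))]
  exact mul_le_of_le_one_left (by split_ifs <;> positivity) (MulChar.norm_apply_le_one _ _)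

theorem diagonal_equation_zero_estimate {F : Type*} [Field F] [Fintype F] {n : ℕ}
    (d : Fin n → ℕ) (hd : ∀ i, 0 < d i) (hddvd : ∀ i, d i ∣ Fintype.card F - 1)
    (a : Fin n → F) (ha : ∀ i, a i ≠ 0) :
    (|(((Finset.univ.filter fun x : Fin n → F =>
              (∀ i, x i ≠ 0) ∧ ∑ i, a i * x i ^ d i = 0).card : ℝ))
          - (1 / (Fintype.card F : ℝ)) * ((Fintype.card F : ℝ) - 1) ^ n|
        ≤ ((Fintype.card F : ℝ) - 1) / (Fintype.card F : ℝ) +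
            ∑ e ∈ Finset.range n,
              ∑ S ∈ Finset.powersetCard (n - e) (Finset.univ : Finset (Fin n)),
                (((S.pi fun j => Finset.Icc 1 (d j - 1))).filter
                      (fun l => ∃ z : ℤ,
                        ∑ j ∈ S.attach, ((l j.1 j.2 : ℚ) / (d j.1 : ℚ)) = (z : ℚ))).card *
                  (((Fintype.card F : ℝ) - 1) *
                    (Fintype.card F : ℝ) ^ (((n : ℝ) - (e : ℝ)) / 2 - 1))) ∧
      ∀ m : ℕ, (∀ i, d i = m) →
        |(((Finset.univ.filter fun x : Fin n → F =>
                (∀ i, x i ≠ 0) ∧ ∑ i, a i * x i ^ d i = 0).card : ℝ))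
            - (1 / (Fintype.card F : ℝ)) * ((Fintype.card F : ℝ) - 1) ^ n|
          ≤ ((Fintype.card F : ℝ) - 1) / (Fintype.card F : ℝ) *
              (1 + ((m : ℝ) - 1) * Real.sqrt (Fintype.card F)) ^ n ∧
        ((Fintype.card F : ℝ) - 1) / (Fintype.card F : ℝ) *
              (1 + ((m : ℝ) - 1) * Real.sqrt (Fintype.card F)) ^ n
          ≤ (1 + ((m : ℝ) - 1) * Real.sqrt (Fintype.card F)) ^ n := by
  have hmain := abs_card_filter_diagonal_sub_le d hd hddvd a ha
  have hq : (1 : ℝ) ≤ Fintype.card F := by exact_mod_cast Fintype.card_pos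
  have hq0 : (0 : ℝ) < Fintype.card F := by linarith
  refine ⟨hmain.trans_eq ?_, fun m hm => ⟨hmain.trans ?_, ?_⟩⟩
  · rw [sum_piFinset_filter_prod hd, Finset.sum_powerset, Finset.card_univ, Fintype.card_fin,
      Finset.sum_range_succ', mul_add, add_comm]
    congr 1
    · have hz : ∃ z : ℤ, (0 : ℚ) = z := ⟨0, by simp⟩
      simp [hz]
    · rw [← Finset.sum_range_reflect, Finset.mul_sum]
      refine Finset.sum_congr rfl fun e he => ?_
      have he' : e < n := Finset.mem_range.1 he
      rw [show n - 1 - e + 1 = n - e by omega, Finset.mul_sum]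
      refine Finset.sum_congr rfl fun S hS => ?_
      have hpow : √(Fintype.card F : ℝ) ^ (n - e) =
          (Fintype.card F : ℝ) ^ (((n : ℝ) - e) / 2 - 1) * Fintype.card F := by
        rw [← Real.rpow_add_one hq0.ne', sub_add_cancel, Real.sqrt_eq_rpow, ← Real.rpow_natCast,
          ← Real.rpow_mul hq0.le, Nat.cast_sub he'.le]
        ring_nf
      rw [(Finset.mem_powersetCard.1 hS).2, hpow]
      field_simp
  · refine mul_le_mul_of_nonneg_left ?_ (div_nonneg (by linarith) hq0.le)
    refine (Finset.sum_le_sum_of_subset_of_nonneg (Finset.filter_subset _ _) fun l _ _ =>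
      Finset.prod_nonneg fun i _ => by split_ifs <;> positivity).trans_eq ?_
    rw [← Finset.prod_univ_sum (fun i => Finset.range (d i))
      (fun _ t => if t = 0 then (1 : ℝ) else √(Fintype.card F))]
    have hfac : ∀ i, ∑ t ∈ Finset.range (d i), (if t = 0 then (1 : ℝ) else √(Fintype.card F)) =
        1 + ((m : ℝ) - 1) * √(Fintype.card F) := fun i => by
      obtain ⟨k, hk⟩ := Nat.exists_eq_succ_of_ne_zero (hd i).ne'
      rw [← hm i, hk, Finset.sum_range_succ']
      simp [add_comm]
    simp [hfac]
  · refine mul_le_of_le_one_left ?_ ((div_le_one hq0).2 (by linarith))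
    rcases n.eq_zero_or_pos with rfl | hn
    · simp
    · have hm1 : (1 : ℝ) ≤ m := by exact_mod_cast (hm ⟨0, hn⟩ ▸ hd ⟨0, hn⟩ : 0 < m)
      have : 0 ≤ (m : ℝ) - 1 := by linarith
      positivity
end

section
/- Let F_q be the finite field of q elements of characteristic p, let H be a multiplicative subgroup of F_q^* of index m, let 1 ≤ k ≤ (q−1)/m, and let b ∈ F_q with b ≠ 0. Let N_H(k,b) be the number of ordered k-tuples (x_1,…,x_k) of pairwise distinct elements of H with x_1 + ⋯ + x_k = b (so N_H(k,b) = k!·M_H(k,b)). Then |N_H(k,b) − (1/q)·((q−1)/m)_k| ≤ (2/√q)·(√q + k + q/(m·p))_k, where (t)_k = t(t−1)⋯(t−k+1) is the falling factorial of a real number t. Moreover, for b = 0: |N_H(k,0) − (1/q)·((q−1)/m)_k| ≤ (√q + k + q/(m·p))_k. -/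
/-- `NH H k b` is the number of ordered `k`-tuples of pairwise distinct elements of
the multiplicative subgroup `H ⊆ Fˣ` (viewed inside `F`) summing to `b`. -/
noncomputable def NH {F : Type*} [Field F] (H : Subgroup Fˣ) (k : ℕ) (b : F) : ℕ :=
  Nat.card {x : Fin k → F //
    Function.Injective x ∧ (∀ i, ∃ u : Fˣ, u ∈ H ∧ (u : F) = x i) ∧ ∑ i, x i = b}

open Finset in
/-- A sum over injective `k`-tuples of a function of their range is `k!` times the sum over
`k`-element subsets. -/
theorem sum_embedding_map_univ {α : Type*} [Fintype α] [DecidableEq α] (k : ℕ)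
    (g : Finset α → ℂ) :
    ∑ x : Fin k ↪ α, g (univ.map x) = k.factorial * ∑ t ∈ powersetCard k univ, g t := by
  rw [← Finset.sum_fiberwise_of_maps_to (s := univ) (t := powersetCard k univ)
    (g := fun x : Fin k ↪ α => univ.map x) (by simp [mem_powersetCard]), Finset.mul_sum]
  refine Finset.sum_congr rfl fun t ht => ?_
  have htk : #t = k := (mem_powersetCard.1 ht).2
  rw [Finset.sum_congr rfl (g := fun _ => g t) (fun x hx => by rw [(mem_filter.1 hx).2]),
    Finset.sum_const, nsmul_eq_mul]
  congr 2
  have h : Fintype.card (Fin k ↪ t) = k.factorial := by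
    rw [Fintype.card_embedding_eq, Fintype.card_coe, htk, Fintype.card_fin, Nat.descFactorial_self]
  rw [← h, ← Finset.card_univ]
  symm
  refine Finset.card_bij (fun y _ => y.trans (Function.Embedding.subtype _)) ?_ ?_ ?_
  · intro y _
    refine mem_filter.2 ⟨mem_univ _, Finset.eq_of_subset_of_card_le ?_ (by simp [htk])⟩
    intro a ha
    obtain ⟨i, -, rfl⟩ := mem_map.1 ha
    exact (y i).2
  · intro y _ z _ hyz
    ext i
    exact DFunLike.congr_fun hyz i
  · intro x hx
    have hx' := (mem_filter.1 hx).2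
    refine ⟨⟨fun i => ⟨x i, hx' ▸ mem_map_of_mem x (mem_univ i)⟩, fun i j hij =>
      x.injective (congrArg Subtype.val hij)⟩, mem_univ _, ?_⟩
    ext i
    rfl

/-- The generalized binomial coefficient `A(A+1)⋯(A+k-1)/k!`. -/
noncomputable def multichooseReal (A : ℝ) (k : ℕ) : ℝ :=
  (∏ i ∈ Finset.range k, (A + i)) / k.factorial

theorem multichooseReal_succ (A : ℝ) (k : ℕ) :
    (k + 1 : ℝ) * multichooseReal A (k + 1) = (A + k) * multichooseReal A k := by
  have := Nat.cast_ne_zero (R := ℝ).2 k.factorial_ne_zero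
  rw [multichooseReal, multichooseReal, Finset.prod_range_succ, Nat.factorial_succ]
  push_cast
  field_simp

theorem mul_multichooseReal (A : ℝ) (k : ℕ) :
    k * multichooseReal A k = A * ∑ j ∈ Finset.range k, multichooseReal A j := by
  induction k with
  | zero => simp
  | succ k ih =>
    rw [Finset.sum_range_succ, mul_add, ← ih]
    push_cast
    rw [multichooseReal_succ]
    ring

theorem multichooseReal_nonneg {A : ℝ} (hA : 0 ≤ A) (k : ℕ) : 0 ≤ multichooseReal A k := by
  unfold multichooseReal
  positivity

theorem multichooseReal_mono {A : ℝ} (hA : 1 ≤ A) : Monotone (multichooseReal A) := by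
  refine monotone_nat_of_le_succ fun k => ?_
  have h1 := multichooseReal_succ A k
  have h2 := multichooseReal_nonneg (zero_le_one.trans hA) k
  have h3 : (0 : ℝ) ≤ k := k.cast_nonneg
  by_contra! h
  nlinarith [mul_nonneg (sub_nonneg.2 hA) h2]

/-- For a nonnegative monotone sequence, the sum over one residue class is at most the average. -/
theorem mul_sum_dvd_sub_le {B : ℕ → ℝ} (hB : Monotone B) (h0 : ∀ j, 0 ≤ B j) {p : ℕ} (hp : 0 < p)
    (k : ℕ) :
    p * ∑ j ∈ Finset.range k, (if p ∣ k - j then B j else 0) ≤ ∑ j ∈ Finset.range k, B j := by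
  induction k using Nat.strong_induction_on with
  | _ k ih =>
    rcases lt_or_ge k p with hk | hk
    · rw [Finset.sum_eq_zero, mul_zero]
      · exact Finset.sum_nonneg fun j _ => h0 j
      · intro j hj
        rw [Finset.mem_range] at hj
        refine if_neg fun h => ?_
        have := Nat.le_of_dvd (by omega) h
        omega
    · obtain ⟨l, rfl⟩ := Nat.exists_eq_add_of_le' hk
      rw [Finset.sum_range_add, Finset.sum_range_add, mul_add]
      refine add_le_add (le_trans (le_of_eq ?_) (ih l (by omega))) ?_
      · congr 1
        refine Finset.sum_congr rfl fun j hj => ?_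
        rw [Finset.mem_range] at hj
        simp [show l + p - j = l - j + p by omega]
      · rw [Finset.sum_eq_single 0]
        · have : ∑ x ∈ Finset.range p, B l ≤ ∑ x ∈ Finset.range p, B (l + x) :=
            Finset.sum_le_sum fun x _ => hB (by omega)
          simpa using this
        · intro x hx hx0
          rw [Finset.mem_range] at hx
          refine if_neg fun h => ?_
          have := Nat.le_of_dvd (by omega) h
          omega
        · intro h
          simp [hp] at h

/-- A recursive inequality of Newton type forces the bound by a generalized binomial coefficient. -/
theorem le_mul_multichooseReal_of_newton {E : ℕ → ℝ} {M s n : ℝ} {p : ℕ} (hp : 0 < p) (hM : 0 ≤ M)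
    (hs : 1 ≤ s) (hn : 0 ≤ n) (h0 : E 0 ≤ M)
    (hE : ∀ (k : ℕ) (C : ℕ → ℝ), 0 < k → (∀ j < k, E j ≤ C j) →
      k * E k ≤ ∑ j ∈ Finset.range k, (if p ∣ k - j then n else s) * C j) (k : ℕ) :
    E k ≤ M * multichooseReal (s + n / p) k := by
  have hA : 1 ≤ s + n / p := le_add_of_le_of_nonneg hs (by positivity)
  have hB0 := multichooseReal_nonneg (zero_le_one.trans hA)
  induction k using Nat.strong_induction_on with
  | _ k ih =>
    rcases k.eq_zero_or_pos with rfl | hk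
    · simpa [multichooseReal] using h0
    have hk' : (0 : ℝ) < k := Nat.cast_pos.2 hk
    have hp' : (0 : ℝ) < p := Nat.cast_pos.2 hp
    refine le_of_mul_le_mul_left ((hE k _ hk ih).trans ?_) hk'
    rw [mul_left_comm, mul_multichooseReal]
    have h := mul_sum_dvd_sub_le (multichooseReal_mono hA) hB0 hp k
    set B := multichooseReal (s + n / p)
    calc ∑ j ∈ Finset.range k, (if p ∣ k - j then n else s) * (M * B j)
        ≤ ∑ j ∈ Finset.range k, (M * s * B j + M * n / p * (p * if p ∣ k - j then B j else 0)) := by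
          refine Finset.sum_le_sum fun j _ => ?_
          have := hB0 j
          split_ifs
          · have h2 : 0 ≤ M * s * B j := by positivity
            have h3 : M * n / p * (p * B j) = n * (M * B j) := by field_simp
            linarith
          · apply le_of_eq
            ring
      _ = M * s * ∑ j ∈ Finset.range k, B j +
          M * n / p * (p * ∑ j ∈ Finset.range k, (if p ∣ k - j then B j else 0)) := by
          rw [Finset.sum_add_distrib, Finset.mul_sum, Finset.mul_sum, Finset.mul_sum]
      _ ≤ M * s * ∑ j ∈ Finset.range k, B j + M * n / p * ∑ j ∈ Finset.range k, B j := by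
          gcongr
      _ = M * ((s + n / p) * ∑ j ∈ Finset.range k, B j) := by ring

section Characters

variable {F : Type*} [Field F] [Fintype F]

theorem norm_mulChar_le_one (χ : MulChar F ℂ) (a : F) : ‖χ a‖ ≤ 1 := by
  by_cases ha : IsUnit a
  · obtain ⟨u, rfl⟩ := ha
    refine le_of_eq (Complex.norm_eq_one_of_pow_eq_one (n := Nat.card Fˣ) ?_ Nat.card_pos.ne')
    rw [← map_pow, ← Units.val_pow_eq_pow_val, pow_card_eq_one', Units.val_one, map_one]
  · simp [χ.map_nonunit ha]

noncomputable instance : Fintype (MulChar F ℂ) := Fintype.ofFinite _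

open Classical in
theorem sum_mulChar_apply (u : Fˣ) :
    ∑ χ : MulChar F ℂ, χ u = if u = 1 then ((Fintype.card F : ℂ) - 1) else 0 := by
  split_ifs with hu
  · have h := MulChar.card_eq_card_units_of_hasEnoughRootsOfUnity F ℂ
    rw [Nat.card_eq_fintype_card, Nat.card_eq_fintype_card, Fintype.card_units] at h
    simp [hu, h, Nat.cast_sub Fintype.card_pos]
  · obtain ⟨χ, hχ⟩ := MulChar.exists_apply_ne_one_of_hasEnoughRootsOfUnity F ℂ
      (a := (u : F)) (by simpa using hu)
    refine eq_zero_of_mul_eq_self_left hχ ?_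
    rw [Finset.mul_sum]
    exact Fintype.sum_bijective _ (Group.mulLeft_bijective χ) _ _ fun _ => rfl

/-- Fourier inversion on `Fˣ` for the restriction of an additive character. -/
theorem sum_gaussSum_inv_mul_apply (ψ : AddChar F ℂ) (u : Fˣ) :
    ∑ χ : MulChar F ℂ, gaussSum χ⁻¹ ψ * χ u = ((Fintype.card F : ℂ) - 1) * ψ u := by
  classical
  have h1 (χ : MulChar F ℂ) : gaussSum χ⁻¹ ψ = ∑ v : Fˣ, χ⁻¹ v * ψ v := by
    refine (Fintype.sum_of_injective _ Units.val_injective _ _ (fun a ha => ?_) fun _ => rfl).symm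
    rw [MulChar.map_nonunit _ ha, zero_mul]
  calc ∑ χ : MulChar F ℂ, gaussSum χ⁻¹ ψ * χ u
      = ∑ v : Fˣ, ψ v * ∑ χ : MulChar F ℂ, χ ((v⁻¹ * u : Fˣ) : F) := by
        simp_rw [h1, Finset.sum_mul, Finset.mul_sum]
        rw [Finset.sum_comm]
        refine Finset.sum_congr rfl fun v _ => Finset.sum_congr rfl fun χ _ => ?_
        rw [MulChar.inv_apply', Units.val_mul, map_mul, Units.val_inv_eq_inv_val]
        ring
    _ = _ := by
        simp_rw [sum_mulChar_apply, inv_mul_eq_one]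
        simp [mul_comm]

theorem sum_norm_sum_subgroup (H : Subgroup Fˣ) [Fintype H] :
    ∑ χ : MulChar F ℂ, ‖∑ u : H, χ ((u : Fˣ) : F)‖ = (Fintype.card F : ℝ) - 1 := by
  classical
  have h (χ : MulChar F ℂ) : ((‖∑ u : H, χ ((u : Fˣ) : F)‖ : ℝ) : ℂ) =
      ∑ u : H, χ ((u : Fˣ) : F) := by
    have := sum_hom_units (((χ : F →* ℂ).comp (Units.coeHom F)).comp H.subtype)
    simp only [MonoidHom.comp_apply] at this
    change ∑ u : H, χ ((u : Fˣ) : F) = _ at this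
    rw [this]
    split_ifs <;> simp
  have h2 : ((∑ χ : MulChar F ℂ, ‖∑ u : H, χ ((u : Fˣ) : F)‖ : ℝ) : ℂ) =
      ((Fintype.card F : ℝ) - 1 : ℝ) := by
    push_cast
    simp_rw [h]
    rw [Finset.sum_comm]
    simp_rw [sum_mulChar_apply]
    simp
  exact_mod_cast h2

theorem norm_sum_mul_psum_le (H : Subgroup Fˣ) [Fintype H] {ψ : AddChar F ℂ}
    (hψ : ψ.IsPrimitive) {f : F → ℂ} {C : ℝ}
    (hf : ∀ χ : MulChar F ℂ, ‖∑ a, χ a * f a‖ ≤ C) (i : ℕ) (χ : MulChar F ℂ) :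
    ‖∑ a, χ a * (f a * ∑ u : H, ψ (a * (u : Fˣ)) ^ i)‖ ≤
      (if ringChar F ∣ i then (Fintype.card H : ℝ) else √(Fintype.card F)) * C := by
  have hcast (a : F) : ∑ u : H, ψ (a * (u : Fˣ)) ^ i = ∑ u : H, ψ (a * (u : Fˣ) * (i : F)) := by
    refine Finset.sum_congr rfl fun u _ => ?_
    rw [← AddChar.map_nsmul_eq_pow, nsmul_eq_mul, mul_comm]
  simp_rw [hcast]
  split_ifs with hi
  · rw [(ringChar.spec F i).2 hi]
    simp only [mul_zero, AddChar.map_zero_eq_one, Finset.sum_const, Finset.card_univ,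
      nsmul_eq_mul, mul_one]
    simp_rw [← mul_assoc]
    rw [← Finset.sum_mul, norm_mul, mul_comm, Complex.norm_natCast]
    exact mul_le_mul_of_nonneg_left (hf χ) (Nat.cast_nonneg _)
  · have hi' : (i : F) ≠ 0 := fun h => hi ((ringChar.spec F i).1 h)
    have hq : (0 : ℝ) < (Fintype.card F : ℝ) - 1 := by
      have := Fintype.one_lt_card (α := F)
      rw [sub_pos]
      exact_mod_cast this
    have hC : 0 ≤ C := (norm_nonneg _).trans (hf χ)
    have key : ((Fintype.card F : ℂ) - 1) *
        ∑ a, χ a * (f a * ∑ u : H, ψ (a * (u : Fˣ) * (i : F))) =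
        ∑ η : MulChar F ℂ, gaussSum η⁻¹ ψ * η i * (∑ u : H, η ((u : Fˣ) : F)) *
          ∑ a, (χ * η) a * f a := by
      simp_rw [Finset.mul_sum, Finset.sum_mul]
      conv_rhs => rw [Finset.sum_comm]
      refine Finset.sum_congr rfl fun a _ => ?_
      conv_rhs => rw [Finset.sum_comm]
      refine Finset.sum_congr rfl fun u _ => ?_
      rcases eq_or_ne a 0 with rfl | ha
      · simp [MulChar.map_zero]
      have h := sum_gaussSum_inv_mul_apply ψ (Units.mk0 a ha * u * Units.mk0 (i : F) hi')
      simp only [Units.val_mul, Units.val_mk0, map_mul] at h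
      calc _ = χ a * f a * (((Fintype.card F : ℂ) - 1) * ψ (a * (u : Fˣ) * (i : F))) := by ring
        _ = _ := by
          rw [← h, Finset.mul_sum]
          refine Finset.sum_congr rfl fun η _ => ?_
          rw [MulChar.mul_apply]
          ring
    have hn := congrArg norm key
    rw [norm_mul, show ‖(Fintype.card F : ℂ) - 1‖ = (Fintype.card F : ℝ) - 1 by
      rw [← abs_of_pos hq, ← Real.norm_eq_abs, ← Complex.norm_real]; push_cast; rfl] at hn
    refine le_of_mul_le_mul_left ?_ hq
    rw [hn]
    calc _ ≤ ∑ η : MulChar F ℂ, √(Fintype.card F) * 1 * ‖∑ u : H, η ((u : Fˣ) : F)‖ * C := by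
          refine (norm_sum_le _ _).trans (Finset.sum_le_sum fun η _ => ?_)
          rw [norm_mul, norm_mul, norm_mul]
          gcongr
          · exact norm_gaussSum_le _ hψ
          · exact norm_mulChar_le_one _ _
          · exact hf _
      _ = _ := by
          rw [← Finset.sum_mul, ← Finset.mul_sum, sum_norm_sum_subgroup]
          ring

open Finset in
/-- Newton's identities bound the twisted sums of elementary symmetric functions of
the values `ψ (a u)`, `u ∈ H`. -/
theorem norm_sum_mul_esymm_le (H : Subgroup Fˣ) [Fintype H] {ψ : AddChar F ℂ}
    (hψ : ψ.IsPrimitive) {g : F → ℂ} {M : ℝ}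
    (hg : ∀ χ : MulChar F ℂ, ‖∑ a, χ a * g a‖ ≤ M) (k : ℕ) (χ : MulChar F ℂ) :
    ‖∑ a, χ a * (g a * ∑ t ∈ powersetCard k (univ : Finset H), ∏ u ∈ t, ψ (a * (u : Fˣ)))‖ ≤
      M * multichooseReal (√(Fintype.card F) + Fintype.card H / ringChar F) k := by
  have hM : 0 ≤ M := (norm_nonneg _).trans (hg χ)
  let e : ℕ → F → ℂ := fun j a =>
    ∑ t ∈ powersetCard j (univ : Finset H), ∏ u ∈ t, ψ (a * (u : Fˣ))
  have newton (k : ℕ) (a : F) : (k : ℂ) * e k a = (-1) ^ (k + 1) *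
      ∑ x ∈ antidiagonal k with x.1 < k,
        (-1) ^ x.1 * e x.1 a * ∑ u : H, ψ (a * (u : Fˣ)) ^ x.2 := by
    have h := congrArg (MvPolynomial.aeval fun u : H => ψ (a * (u : Fˣ)))
      (MvPolynomial.mul_esymm_eq_sum H ℂ k)
    simpa [MvPolynomial.esymm, MvPolynomial.psum, map_sum, map_prod] using h
  let E : ℕ → ℝ := fun j => ⨆ χ : MulChar F ℂ, ‖∑ a, χ a * (g a * e j a)‖
  have hle (j : ℕ) (χ : MulChar F ℂ) : ‖∑ a, χ a * (g a * e j a)‖ ≤ E j :=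
    le_ciSup (f := fun χ : MulChar F ℂ => ‖∑ a, χ a * (g a * e j a)‖)
      (Set.finite_range _).bddAbove χ
  refine (hle k χ).trans (le_mul_multichooseReal_of_newton
    (Nat.pos_of_ne_zero (CharP.ringChar_ne_zero_of_finite F)) hM ?_ (Nat.cast_nonneg _) ?_ ?_ k)
  · rw [Real.one_le_sqrt]
    exact_mod_cast Fintype.card_pos
  · exact ciSup_le fun χ => by simpa [e] using hg χ
  · intro k C hk hC
    rw [mul_comm, ← le_div_iff₀ (Nat.cast_pos.2 hk)]
    refine ciSup_le fun χ => ?_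
    rw [le_div_iff₀ (Nat.cast_pos.2 hk), mul_comm]
    calc (k : ℝ) * ‖∑ a, χ a * (g a * e k a)‖
        = ‖∑ x ∈ antidiagonal k with x.1 < k, (-1) ^ (k + 1) * (-1) ^ x.1 *
            ∑ a, χ a * (g a * e x.1 a * ∑ u : H, ψ (a * (u : Fˣ)) ^ x.2)‖ := by
          rw [← Complex.norm_natCast, ← norm_mul, mul_sum]
          congr 1
          simp_rw [mul_sum (s := (univ : Finset F))]
          rw [sum_comm]
          refine sum_congr rfl fun a _ => ?_
          rw [mul_left_comm, mul_left_comm (k : ℂ), newton, mul_sum, mul_sum, mul_sum]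
          refine sum_congr rfl fun x _ => ?_
          ring
      _ ≤ ∑ x ∈ antidiagonal k with x.1 < k,
            (if ringChar F ∣ x.2 then (Fintype.card H : ℝ) else √(Fintype.card F)) * C x.1 := by
          refine (norm_sum_le _ _).trans (sum_le_sum fun x hx => ?_)
          rw [norm_mul, norm_mul, norm_pow, norm_pow, norm_neg, norm_one, one_pow, one_pow,
            one_mul, one_mul]
          exact norm_sum_mul_psum_le H hψ
            (fun η => (hle _ η).trans (hC _ (mem_filter.1 hx).2)) _ χ
      _ = _ := by
          rw [sum_filter, Nat.sum_antidiagonal_eq_sum_range_succ_mk, sum_range_succ]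
          simp only [lt_irrefl, if_false, add_zero]
          exact sum_congr rfl fun j hj => if_pos (mem_range.1 hj)

end Characters

section Counting

theorem addChar_map_sum {ι G : Type*} [AddCommMonoid G] (ψ : AddChar G ℂ) (s : Finset ι)
    (f : ι → G) : ψ (∑ i ∈ s, f i) = ∏ i ∈ s, ψ (f i) :=
  map_prod ψ.toMonoidHom (fun i => Multiplicative.ofAdd (f i)) s

open Finset in
theorem NH_eq_factorial_mul {F : Type*} [Field F] [DecidableEq F] (H : Subgroup Fˣ) [Fintype H]
    (k : ℕ) (b : F) :
    (NH H k b : ℂ) = k.factorial *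
      ∑ t ∈ powersetCard k (univ : Finset H), if ∑ u ∈ t, ((u : Fˣ) : F) = b then 1 else 0 := by
  classical
  rw [← sum_embedding_map_univ, NH, sum_boole, ← Fintype.card_subtype, ← Nat.card_eq_fintype_card]
  congr 1
  symm
  refine Nat.card_congr (Equiv.ofBijective (fun x => ⟨fun i => ((x.1 i : Fˣ) : F),
    fun i j hij => x.1.injective (Subtype.ext (Units.ext hij)),
    fun i => ⟨x.1 i, (x.1 i).2, rfl⟩, by simpa using x.2⟩) ⟨?_, ?_⟩)
  · intro x y hxy
    refine Subtype.ext (DFunLike.ext _ _ fun i => Subtype.ext (Units.ext ?_))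
    exact congrFun (congrArg Subtype.val hxy) i
  · rintro ⟨x, hx, hxH, hsum⟩
    have hxH' := hxH
    choose u hu hux using hxH'
    refine ⟨⟨⟨fun i => ⟨u i, hu i⟩, fun i j hij => hx ?_⟩, ?_⟩, ?_⟩
    · rw [← hux, ← hux, Subtype.mk.inj hij]
    · rw [sum_map]
      exact (sum_congr rfl fun i _ => hux i).trans hsum
    · ext i
      exact hux i

variable {F : Type*} [Field F] [Fintype F]

open Finset in
theorem card_mul_NH_eq (H : Subgroup Fˣ) [Fintype H] {ψ : AddChar F ℂ}
    (hψ : ψ.IsPrimitive) (k : ℕ) (b : F) :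
    Fintype.card F * (NH H k b : ℂ) = k.factorial *
      ((Fintype.card H).choose k + ∑ a, (1 : MulChar F ℂ) a * (ψ (a * -b) *
        ∑ t ∈ powersetCard k (univ : Finset H), ∏ u ∈ t, ψ (a * (u : Fˣ)))) := by
  classical
  have h1 : (Fintype.card F : ℂ) *
      ∑ t ∈ powersetCard k (univ : Finset H), (if ∑ u ∈ t, ((u : Fˣ) : F) = b then 1 else 0) =
      ∑ a, ψ (a * -b) * ∑ t ∈ powersetCard k (univ : Finset H), ∏ u ∈ t, ψ (a * (u : Fˣ)) := by
    simp_rw [mul_sum]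
    rw [sum_comm]
    refine sum_congr rfl fun t _ => ?_
    have h := AddChar.sum_mulShift (∑ u ∈ t, ((u : Fˣ) : F) - b) hψ
    rw [sub_eq_zero] at h
    rw [mul_ite, mul_one, mul_zero, ← Nat.cast_zero, ← Nat.cast_ite, ← h]
    refine sum_congr rfl fun a _ => ?_
    rw [← addChar_map_sum, ← AddChar.map_add_eq_mul, ← mul_sum]
    ring_nf
  rw [NH_eq_factorial_mul, mul_left_comm, h1, ← add_sum_erase _ _ (mem_univ (0 : F)),
    ← add_sum_erase _ (fun a => (1 : MulChar F ℂ) a * _) (mem_univ (0 : F))]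
  congr 2
  · simp
  · rw [MulChar.map_zero, zero_mul, zero_add]
    refine sum_congr rfl fun a ha => ?_
    rw [MulChar.one_apply (Ne.isUnit (ne_of_mem_erase ha)), one_mul]

theorem abs_NH_sub_le (H : Subgroup Fˣ) [Fintype H] {ψ : AddChar F ℂ}
    (hψ : ψ.IsPrimitive) (k : ℕ) (b : F) {M : ℝ}
    (hM : ∀ χ : MulChar F ℂ, ‖∑ a, χ a * ψ (a * -b)‖ ≤ M) :
    |(NH H k b : ℝ) - 1 / Fintype.card F * (Fintype.card H).descFactorial k| ≤
      M / Fintype.card F *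
        ∏ i ∈ Finset.range k, (√(Fintype.card F) + Fintype.card H / ringChar F + i) := by
  have hq : (0 : ℝ) < Fintype.card F := Nat.cast_pos.2 Fintype.card_pos
  have hk : (0 : ℝ) < k.factorial := Nat.cast_pos.2 k.factorial_pos
  have h := card_mul_NH_eq H hψ k b
  have hb := norm_sum_mul_esymm_le H hψ hM k 1
  rw [mul_add, ← Nat.cast_mul k.factorial, ← Nat.descFactorial_eq_factorial_mul_choose,
    ← sub_eq_iff_eq_add'] at h
  have hn := congrArg norm h
  rw [norm_mul, Complex.norm_natCast] at hn
  have hl : ‖(Fintype.card F : ℂ) * (NH H k b : ℂ) - ((Fintype.card H).descFactorial k : ℕ)‖ =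
      Fintype.card F *
        |(NH H k b : ℝ) - 1 / Fintype.card F * (Fintype.card H).descFactorial k| := by
    rw [← abs_of_pos hq, ← abs_mul, abs_of_pos hq, ← Real.norm_eq_abs, ← Complex.norm_real]
    congr 1
    push_cast
    have : (Fintype.card F : ℂ) ≠ 0 := by exact_mod_cast hq.ne'
    field_simp
  rw [hl] at hn
  refine le_of_mul_le_mul_left ?_ hq
  rw [hn]
  refine (mul_le_mul_of_nonneg_left hb hk.le).trans (le_of_eq ?_)
  rw [multichooseReal]
  field_simp

theorem prod_add_le_fallingFactorial {A B : ℝ} (hA : 0 ≤ A) (h : A ≤ B) (k : ℕ) :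
    ∏ i ∈ Finset.range k, (A + i) ≤ fallingFactorial (B + k) k := by
  rw [fallingFactorial, descPochhammer_eval_eq_prod_range,
    ← Finset.prod_range_reflect (fun i => A + (i : ℝ))]
  refine Finset.prod_le_prod (fun i _ => by positivity) fun i hi => ?_
  have hi' : ((k - 1 - i : ℕ) : ℝ) ≤ k - i := by
    rw [le_sub_iff_add_le]
    have := Finset.mem_range.1 hi
    exact_mod_cast (by omega : k - 1 - i + i ≤ k)
  linarith

end Counting

theorem ordered_subset_sum_subgroup_estimate
    {F : Type*} [Field F] [Fintype F] (H : Subgroup Fˣ) (m : ℕ) (hm : H.index = m)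
    (k : ℕ) (hk1 : 1 ≤ k) (hk2 : (k : ℝ) ≤ ((Fintype.card F : ℝ) - 1) / m)
    (b : F) (hb : b ≠ 0) :
    |(NH H k b : ℝ) -
          (1 / (Fintype.card F : ℝ)) *
            fallingFactorial (((Fintype.card F : ℝ) - 1) / m) k|
        ≤ (2 / Real.sqrt (Fintype.card F)) *
            fallingFactorial (Real.sqrt (Fintype.card F) + k +
              (Fintype.card F : ℝ) / (m * ringChar F)) k ∧
      |(NH H k (0 : F) : ℝ) -
          (1 / (Fintype.card F : ℝ)) *
            fallingFactorial (((Fintype.card F : ℝ) - 1) / m) k|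
        ≤ fallingFactorial (Real.sqrt (Fintype.card F) + k +
            (Fintype.card F : ℝ) / (m * ringChar F)) k := by
  classical
  have hq : (0 : ℝ) < Fintype.card F := Nat.cast_pos.2 Fintype.card_pos
  have hs : 0 < √(Fintype.card F : ℝ) := Real.sqrt_pos.2 hq
  have hm0 : (0 : ℝ) < m := by
    rw [← hm]
    exact Nat.cast_pos.2 (Nat.pos_of_ne_zero H.index_ne_zero_of_finite)
  have hp : (0 : ℝ) < ringChar F :=
    Nat.cast_pos.2 (Nat.pos_of_ne_zero (CharP.ringChar_ne_zero_of_finite F))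
  have hH : ((Fintype.card F : ℝ) - 1) / m = Fintype.card H := by
    rw [div_eq_iff hm0.ne', ← hm, ← Nat.card_eq_fintype_card (α := H), ← Nat.cast_mul,
      H.card_mul_index, Nat.card_eq_fintype_card, Fintype.card_units,
      Nat.cast_sub Fintype.card_pos, Nat.cast_one]
  have hmain : fallingFactorial (((Fintype.card F : ℝ) - 1) / m) k =
      (Fintype.card H).descFactorial k := by
    rw [hH, fallingFactorial, descPochhammer_eval_eq_descFactorial]
  have hprod : ∏ i ∈ Finset.range k,
      (√(Fintype.card F : ℝ) + Fintype.card H / ringChar F + i) ≤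
      fallingFactorial (√(Fintype.card F) + k + (Fintype.card F : ℝ) / (m * ringChar F)) k := by
    rw [add_right_comm]
    refine prod_add_le_fallingFactorial (by positivity) ?_ k
    rw [← hH, div_div]
    gcongr
    linarith
  have hprod0 : 0 ≤ ∏ i ∈ Finset.range k,
      (√(Fintype.card F : ℝ) + Fintype.card H / ringChar F + i) := by positivity
  obtain ⟨ψ, hψ1⟩ := AddChar.exists_apply_ne_zero.2 (one_ne_zero (α := F))
  have hψ : ψ.IsPrimitive := AddChar.IsPrimitive.of_ne_one (AddChar.ne_one_iff.2 ⟨1, hψ1⟩)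
  rw [hmain]
  constructor
  · refine (abs_NH_sub_le H hψ k b (M := √(Fintype.card F)) fun χ => ?_).trans ?_
    · have hgauss := norm_gaussSum_le χ (ψ := ψ.mulShift (-b)) ?_
      · simpa [gaussSum, AddChar.mulShift_apply, mul_comm] using hgauss
      · exact AddChar.IsPrimitive.of_ne_one (hψ (neg_ne_zero.2 hb))
    · rw [Real.sqrt_div_self']
      gcongr
      norm_num
  · refine (abs_NH_sub_le H hψ k 0 (M := Fintype.card F) fun χ => ?_).trans ?_
    · refine (norm_sum_le _ _).trans ?_
      simpa using Finset.sum_le_sum fun a (_ : a ∈ Finset.univ) => norm_mulChar_le_one χ a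
    · rwa [div_self hq.ne', one_mul]
end
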